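/- Assume (A1)–(A6) and α − β − 1 < 4θ/(β+1). For ρ > 0 let u(·,ρ) be the regular solution of L(u) + e^{f(u)} = 0 with u(0,ρ) = ρ and ∂_r u(0,ρ) = 0, let R(0,ρ) be its unique zero, and set λ(ρ) = R(0,ρ)^θ. Let u* : (0,∞) → ℝ be a C², strictly decreasing solution of L(u) + e^{f(u)} = 0 on (0,∞) with u*(r) → +∞ as r → 0+, satisfying the representation u*(r) = F^{−1}( K r^{θ/(β+1)} (1 + δ(r)) ) where δ(r) → 0 as r → 0+, F(u) = ∫_u^∞ e^{−f(s)/(β+1)} ds and K = ((β+1)/θ)(α−β−1)^{−1/(β+1)}, and let λ* > 0 be such that (λ*)^{1/θ} is the unique zero of u*. Then: (i) for every M > 0 there exist ρ₁, ρ₂ > M with λ(ρ₁) > λ* and λ(ρ₂) < λ* (λ(ρ) oscillates around λ* as ρ → +∞); (ii) the set { ρ > 0 : λ(ρ) = λ* } is unbounded, so there are infinitely many regular solutions of L(u) + λ* e^{f(u)} = 0, u > 0 on [0,1), u(1) = 0. -/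

import Mathlib

open Filter Set Asymptotics Real MeasureTheory

namespace RadialLiouville

section OscillationCriterion

/-- A pair of functions whose derivatives are controlled by the pair itself vanishes to the left
of any common zero. -/
theorem eq_zero_of_hasDerivAt_le {D E D' E' : ℝ → ℝ} {a b C : ℝ} (hab : a ≤ b)
    (hD : ∀ r ∈ Icc a b, HasDerivAt D (D' r) r) (hE : ∀ r ∈ Icc a b, HasDerivAt E (E' r) r)
    (hD' : ∀ r ∈ Icc a b, |D' r| ≤ C * (|D r| + |E r|))
    (hE' : ∀ r ∈ Icc a b, |E' r| ≤ C * (|D r| + |E r|))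
    (hDb : D b = 0) (hEb : E b = 0) : D a = 0 := by
  have hN : ∀ r ∈ Icc a b, HasDerivAt (fun r => (D r ^ 2 + E r ^ 2) * exp (4 * C * r))
      ((2 * D r * D' r + 2 * E r * E' r + 4 * C * (D r ^ 2 + E r ^ 2)) * exp (4 * C * r)) r := by
    intro r hr
    have h1 := ((hD r hr).pow 2).add ((hE r hr).pow 2)
    have h2 : HasDerivAt (fun r => exp (4 * C * r)) (exp (4 * C * r) * (4 * C)) r := by
      simpa using ((hasDerivAt_id r).const_mul (4 * C)).exp
    refine (h1.mul h2).congr_deriv ?_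
    simp
    ring
  have hmono : MonotoneOn (fun r => (D r ^ 2 + E r ^ 2) * exp (4 * C * r)) (Icc a b) := by
    refine monotoneOn_of_deriv_nonneg (convex_Icc a b)
      (fun r hr => (hN r hr).continuousAt.continuousWithinAt)
      (fun r hr => (hN r (interior_subset hr)).differentiableAt.differentiableWithinAt) ?_
    intro r hr
    have hr := interior_subset hr
    rw [(hN r hr).deriv]
    refine mul_nonneg ?_ (exp_pos _).le
    have h1 : -(2 * D r * D' r) ≤ 2 * |D r| * (C * (|D r| + |E r|)) := by
      calc -(2 * D r * D' r) ≤ |2 * D r * D' r| := neg_le_abs _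
        _ = 2 * |D r| * |D' r| := by rw [abs_mul, abs_mul, abs_two]
        _ ≤ _ := by gcongr; exact hD' r hr
    have h2 : -(2 * E r * E' r) ≤ 2 * |E r| * (C * (|D r| + |E r|)) := by
      calc -(2 * E r * E' r) ≤ |2 * E r * E' r| := neg_le_abs _
        _ = 2 * |E r| * |E' r| := by rw [abs_mul, abs_mul, abs_two]
        _ ≤ _ := by gcongr; exact hE' r hr
    have hd := sq_abs (D r)
    have he := sq_abs (E r)
    by_cases hC : 0 ≤ C
    · nlinarith [mul_nonneg hC (sq_nonneg (|D r| - |E r|))]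
    · have h3 : |D r| + |E r| ≤ 0 := by
        by_contra! h
        nlinarith [abs_nonneg (D' r), hD' r hr, mul_neg_of_neg_of_pos (not_le.mp hC) h]
      have h4 : |D r| = 0 := by linarith [abs_nonneg (D r), abs_nonneg (E r)]
      have h5 : |E r| = 0 := by linarith [abs_nonneg (D r), abs_nonneg (E r)]
      rw [abs_eq_zero] at h4 h5
      simp [h4, h5]
  have h := hmono (left_mem_Icc.2 hab) (right_mem_Icc.2 hab) hab
  simp only [hDb, hEb] at h
  have h1 : (D a ^ 2 + E a ^ 2) ≤ 0 := by
    by_contra! h'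
    have := mul_pos h' (exp_pos (4 * C * a))
    simp at h
    linarith
  nlinarith [sq_nonneg (D a), sq_nonneg (E a)]

theorem le_of_hasDerivAt_ge {x x' : ℝ → ℝ} {T c : ℝ} (hx : ∀ t, T ≤ t → HasDerivAt x (x' t) t)
    (hc : ∀ t, T ≤ t → c ≤ x' t) : ∀ t, T ≤ t → x T + c * (t - T) ≤ x t := by
  intro t ht
  have hd : ∀ s ∈ Icc T t, HasDerivAt (fun s => x s - c * s) (x' s - c) s := fun s hs =>
    ((hx s hs.1).sub ((hasDerivAt_id s).const_mul c)).congr_deriv (by simp)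
  have := monotoneOn_of_deriv_nonneg (convex_Icc T t)
    (fun s hs => (hd s hs).continuousAt.continuousWithinAt)
    (fun s hs => (hd s (interior_subset hs)).differentiableAt.differentiableWithinAt)
    (fun s hs => by
      rw [(hd s (interior_subset hs)).deriv]; linarith [hc s (interior_subset hs).1])
    (left_mem_Icc.2 ht) (right_mem_Icc.2 ht) ht
  simp only at this
  linarith

theorem exists_neg_of_hasDerivAt_le {x x' : ℝ → ℝ} {T c : ℝ} (hc0 : 0 < c)
    (hx : ∀ t, T ≤ t → HasDerivAt x (x' t) t)
    (hc : ∀ t, T ≤ t → x' t ≤ -c) : ∃ t, T ≤ t ∧ x t < 0 := by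
  have h := le_of_hasDerivAt_ge (x := fun t => -x t) (x' := fun t => -x' t) (T := T) (c := c)
    (fun t ht => (hx t ht).neg) (fun t ht => by linarith [hc t ht])
  refine ⟨T + (|x T| + 1) / c, by have : 0 ≤ (|x T| + 1) / c := by positivity
                                  linarith, ?_⟩
  have h1 := h (T + (|x T| + 1) / c) (by
    have : 0 ≤ (|x T| + 1) / c := by positivity
    linarith)
  have h2 : c * (T + (|x T| + 1) / c - T) = |x T| + 1 := by field_simp; ring
  rw [h2] at h1
  linarith [le_abs_self (x T)]

/-- Damped relaxation: if `x' ≥ a (m - x)` then eventually `x > m'` for every `m' < m`. -/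
theorem eventually_lt_of_relaxation {x x' : ℝ → ℝ} {T a m m' : ℝ} (ha : 0 < a) (hm : m' < m)
    (hx : ∀ t, T ≤ t → HasDerivAt x (x' t) t)
    (hx' : ∀ t, T ≤ t → a * (m - x t) ≤ x' t) : ∀ᶠ t in atTop, m' < x t := by
  have hd : ∀ t, T ≤ t → HasDerivAt (fun t => (x t - m) * exp (a * t))
      ((x' t - a * (m - x t)) * exp (a * t)) t := fun t ht => by
    have h2 : HasDerivAt (fun r => exp (a * r)) (exp (a * t) * a) t := by
      simpa using ((hasDerivAt_id t).const_mul a).exp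
    refine (((hx t ht).sub_const m).mul h2).congr_deriv ?_
    ring
  have h := le_of_hasDerivAt_ge hd (c := 0) (fun t ht =>
    mul_nonneg (by linarith [hx' t ht]) (exp_pos _).le)
  have hlim : Tendsto (fun t => ((x T - m) * exp (a * T)) * exp (-(a * t))) atTop (nhds 0) := by
    have : Tendsto (fun t => exp (-(a * t))) atTop (nhds 0) :=
      tendsto_exp_neg_atTop_nhds_zero.comp (tendsto_id.const_mul_atTop ha)
    simpa using this.const_mul ((x T - m) * exp (a * T))
  filter_upwards [hlim.eventually (lt_mem_nhds (show m' - m < 0 by linarith)),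
    eventually_ge_atTop T] with t h1 h2
  have h3 := h t h2
  simp only [zero_mul, add_zero] at h3
  have h4 : (x T - m) * exp (a * T) * exp (-(a * t)) ≤
        (x t - m) * exp (a * t) * exp (-(a * t)) := by
    gcongr
  rw [mul_assoc (x t - m), ← exp_add, add_neg_cancel, exp_zero, mul_one] at h4
  linarith

/-- The planar system `x' = a (φ q - x)`, `q' = -ψ x` has a focus at the origin when
`a < 4 ψ' 0` and `φ' 0 = 1`: no solution keeps `q` positive. -/
theorem not_forall_pos_of_focus {x q φ ψ : ℝ → ℝ} {a k T : ℝ} (ha : 0 < a) (hk : a < 4 * k)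
    (hφm : Monotone φ) (hψm : Monotone ψ) (hφ0 : φ 0 = 0) (hψ0 : ψ 0 = 0)
    (hφpos : ∀ y, 0 < y → 0 < φ y) (hψpos : ∀ y, 0 < y → 0 < ψ y)
    (hφd : HasDerivAt φ 1 0) (hψd : HasDerivAt ψ k 0)
    (hx : ∀ t, T ≤ t → HasDerivAt x (a * (φ (q t) - x t)) t)
    (hq : ∀ t, T ≤ t → HasDerivAt q (-ψ (x t)) t) : ¬ ∀ t, T ≤ t → 0 < q t := by
  intro hpos
  -- `x` becomes positive
  obtain ⟨T₁, hT₁, hxT₁⟩ : ∃ t, T ≤ t ∧ 0 < x t := by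
    by_contra! hcon
    have hqm := le_of_hasDerivAt_ge hq (c := 0) (fun t ht => by
      have := hψm (hcon t ht); rw [hψ0] at this; linarith)
    obtain ⟨t, ht, h⟩ := exists_neg_of_hasDerivAt_le (x := fun t => -x t)
      (mul_pos ha (hφpos _ (hpos T le_rfl))) (fun t ht => (hx t ht).neg) (fun t ht => by
        have h1 := hqm t ht
        rw [zero_mul, add_zero] at h1
        have h2 := hφm h1
        have h3 := hcon t ht
        nlinarith)
    linarith [hcon t ht]
  have hxpos : ∀ t, T₁ ≤ t → 0 < x t := by
    have hd : ∀ t, T₁ ≤ t → HasDerivAt (fun t => x t * exp (a * t))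
        (a * φ (q t) * exp (a * t)) t := fun t ht => by
      have h2 : HasDerivAt (fun r => exp (a * r)) (exp (a * t) * a) t := by
        simpa using ((hasDerivAt_id t).const_mul a).exp
      refine ((hx t (hT₁.trans ht)).mul h2).congr_deriv ?_
      ring
    have h := le_of_hasDerivAt_ge hd (c := 0) (fun t ht =>
      mul_nonneg (mul_nonneg ha.le (hφpos _ (hpos t (hT₁.trans ht))).le) (exp_pos _).le)
    intro t ht
    have h1 := h t ht
    rw [zero_mul, add_zero] at h1
    have h2 : 0 < x t * exp (a * t) := (mul_pos hxT₁ (exp_pos _)).trans_le h1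
    exact pos_of_mul_pos_left h2 (exp_pos _).le
  have hqanti : ∀ s t, T₁ ≤ s → s ≤ t → q t ≤ q s := by
    intro s t hs hst
    have h := le_of_hasDerivAt_ge (x := fun t => -q t) (x' := fun t => ψ (x t)) (c := 0) (T := s)
      (fun t ht => (hq t (hT₁.trans (hs.trans ht))).neg.congr_deriv (neg_neg _))
      (fun t ht => (hψpos _ (hxpos t (hs.trans ht))).le) t hst
    linarith
  have hq0 : Tendsto q atTop (nhds 0) := by
    rw [Metric.tendsto_atTop]
    intro ε hε
    obtain ⟨t, ht, hlt⟩ : ∃ t, T₁ ≤ t ∧ q t < ε := by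
      by_contra! hcon
      obtain ⟨T₂, hT₂⟩ := eventually_atTop.1 (eventually_lt_of_relaxation (T := T₁) ha
        (show φ ε / 2 < φ ε by linarith [hφpos ε hε]) (fun t ht => hx t (hT₁.trans ht))
        (fun t ht => by
          have := hφm (hcon t ht)
          gcongr))
      obtain ⟨t, ht, h⟩ := exists_neg_of_hasDerivAt_le (T := max T₁ T₂)
        (hψpos (φ ε / 2) (by linarith [hφpos ε hε]))
        (fun t ht => hq t (hT₁.trans ((le_max_left _ _).trans ht)))
        (fun t ht => neg_le_neg (hψm (hT₂ t ((le_max_right _ _).trans ht)).le))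
      linarith [hcon t ((le_max_left _ _).trans ht)]
    refine ⟨t, fun s hs => ?_⟩
    rw [Real.dist_eq, sub_zero, abs_of_pos (hpos s (hT₁.trans (ht.trans hs)))]
    exact (hqanti t s ht hs).trans_lt hlt
  have hφq : Tendsto (fun t => φ (q t)) atTop (nhds 0) := by
    have := hφd.continuousAt.tendsto.comp hq0
    rwa [hφ0] at this
  have hx0 : Tendsto x atTop (nhds 0) := by
    rw [Metric.tendsto_nhds]
    intro ε hε
    obtain ⟨T₂, hT₂⟩ := eventually_atTop.1 (hφq.eventually (gt_mem_nhds (half_pos hε)))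
    have h := eventually_lt_of_relaxation (x := fun t => -x t) (T := max T₁ T₂) ha
      (m := -(ε / 2)) (m' := -ε) (by linarith)
      (fun t ht => (hx t (hT₁.trans ((le_max_left _ _).trans ht))).neg) (fun t ht => by
        have := hT₂ t ((le_max_right _ _).trans ht)
        nlinarith)
    filter_upwards [h, eventually_ge_atTop T₁] with t h1 h2
    rw [Real.dist_eq, sub_zero, abs_of_pos (hxpos t h2)]
    linarith
  -- the slope `q / x` decreases at a uniform rate
  obtain ⟨η, hη0, hη1, hη⟩ : ∃ η : ℝ, 0 < η ∧ η < 1 ∧ a < 4 * (1 - η) * (k - 2 * η) := by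
    have hcont : Tendsto (fun η : ℝ => 4 * (1 - η) * (k - 2 * η)) (nhdsWithin 0 (Ioi 0))
        (nhds (4 * (1 - 0) * (k - 2 * 0))) :=
      (Continuous.tendsto (by fun_prop) 0).mono_left nhdsWithin_le_nhds
    have h1 := hcont.eventually (lt_mem_nhds (show a < 4 * (1 - 0) * (k - 2 * 0) by linarith))
    have h2 : ∀ᶠ η : ℝ in nhdsWithin 0 (Ioi 0), η < 1 :=
      (gt_mem_nhds (show (0:ℝ) < 1 by norm_num)).filter_mono nhdsWithin_le_nhds
    obtain ⟨η, h⟩ := (h1.and (h2.and self_mem_nhdsWithin)).exists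
    exact ⟨η, h.2.2, h.2.1, h.1⟩
  have hφs : ∀ᶠ y in nhds (0:ℝ), |φ y - y| ≤ η * |y| := by
    simpa [hφ0] using hφd.isLittleO.def hη0
  have hψs : ∀ᶠ y in nhds (0:ℝ), |ψ y - y * k| ≤ η * |y| := by
    simpa [hψ0] using hψd.isLittleO.def hη0
  obtain ⟨T₂, hT₂⟩ := eventually_atTop.1 ((hq0.eventually hφs).and (hx0.eventually hψs))
  obtain ⟨t, ht, h⟩ := exists_neg_of_hasDerivAt_le (T := max T₁ T₂) (x := fun t => q t / x t) hη0
    (fun t ht => (hq t (hT₁.trans ((le_max_left _ _).trans ht))).div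
      (hx t (hT₁.trans ((le_max_left _ _).trans ht)))
      (hxpos t ((le_max_left _ _).trans ht)).ne') (fun t ht => by
        have hxt := hxpos t ((le_max_left _ _).trans ht)
        have hqt := hpos t (hT₁.trans ((le_max_left _ _).trans ht))
        obtain ⟨h1, h2⟩ := hT₂ t ((le_max_right _ _).trans ht)
        rw [abs_of_pos hqt] at h1
        rw [abs_of_pos hxt] at h2
        have h1' := (abs_le.1 h1).1
        have h2' := (abs_le.1 h2).1
        rw [div_le_iff₀ (by positivity)]
        have e1 : (k - η) * x t * x t ≤ ψ (x t) * x t := by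
          gcongr; linarith
        have e2 : q t * (a * ((1 - η) * q t - x t)) ≤ q t * (a * (φ (q t) - x t)) := by
          gcongr; linarith
        have hη' : 0 < 1 - η := by linarith
        have e3 : 0 ≤ (k - 2 * η) * x t ^ 2 - a * (q t * x t) + a * (1 - η) * q t ^ 2 := by
          have : 0 ≤ (4 * (1 - η)) *
              ((k - 2 * η) * x t ^ 2 - a * (q t * x t) + a * (1 - η) * q t ^ 2) := by
            nlinarith [mul_nonneg ha.le (sq_nonneg (2 * (1 - η) * q t - x t)),
              mul_nonneg (sub_nonneg.2 hη.le) (sq_nonneg (x t))]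
          exact nonneg_of_mul_nonneg_right this (by positivity)
        nlinarith)
  exact absurd h (not_lt.2 (div_pos (hpos t (hT₁.trans ((le_max_left _ _).trans ht)))
    (hxpos t ((le_max_left _ _).trans ht))).le)

end OscillationCriterion

section ZeroCounting

/-- `D` takes alternating signs, starting with a negative one, at `n` increasing points of
`(0, d]`. -/
def Alternates (D : ℝ → ℝ) (d : ℝ) (n : ℕ) : Prop :=
  ∃ r : ℕ → ℝ, (∀ i < n, r i ∈ Ioc 0 d) ∧ (∀ i, i + 1 < n → r i < r (i + 1)) ∧
    ∀ i < n, (-1) ^ i * D (r i) < 0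

/-- `z` lists `n` zeros of `D` in `[c, d]`, at which `E` has weakly alternating signs. -/
def AlternatingZeros (D E : ℝ → ℝ) (c d : ℝ) (n : ℕ) (z : ℕ → ℝ) : Prop :=
  (∀ i < n, z i ∈ Icc c d) ∧ (∀ i, i + 1 < n → z i ≤ z (i + 1)) ∧
    (∀ i < n, D (z i) = 0) ∧ ∀ i < n, (-1) ^ i * E (z i) ≤ 0

/-- The zeros of `D` on `(0, d]` are transversal, with crossing direction opposite to the sign
of `E`; moreover `D` is negative on `(0, c]`. -/
structure Transversal (D E : ℝ → ℝ) (c d : ℝ) : Prop where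
  neg : ∀ r, 0 < r → r ≤ c → D r < 0
  cont : ContinuousOn D (Ioc 0 d)
  left : ∀ z ∈ Ioc 0 d, D z = 0 → ∀ σ : ℝ, σ * E z < 0 → ∀ᶠ r in nhdsWithin z (Iio z), σ * D r < 0
  isolated : ∀ z ∈ Ioc 0 d, D z = 0 → ∀ᶠ r in nhdsWithin z {z}ᶜ, D r ≠ 0
  ne : ∀ z ∈ Ioc 0 d, D z = 0 → E z ≠ 0

variable {D E : ℝ → ℝ} {c d : ℝ} {n : ℕ}

theorem Transversal.exists_zero (h : Transversal D E c d) {a b σ : ℝ} (ha : 0 < a) (hab : a ≤ b)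
    (hbd : b ≤ d) (hDa : σ * D a < 0) (hDb : 0 ≤ σ * D b) :
    ∃ z ∈ Icc a b, D z = 0 ∧ σ * E z ≤ 0 := by
  have hcont : ContinuousOn (fun r => σ * D r) (Icc a b) :=
    (h.cont.mono fun r hr => ⟨ha.trans_le hr.1, hr.2.trans hbd⟩).const_smul σ
  have hσ : σ ≠ 0 := by rintro rfl; simp at hDa
  have hS : IsCompact (Icc a b ∩ (fun r => σ * D r) ⁻¹' Ici 0) :=
    isCompact_Icc.of_isClosed_subset (hcont.preimage_isClosed_of_isClosed isClosed_Icc isClosed_Ici)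
      inter_subset_left
  obtain ⟨z, ⟨hz, hDz⟩, hmin⟩ := hS.exists_isLeast ⟨b, right_mem_Icc.2 hab, hDb⟩
  have haz : a < z := lt_of_le_of_ne hz.1 (by rintro rfl; exact absurd hDa (not_lt.2 hDz))
  have hlt : ∀ r ∈ Ico a z, σ * D r < 0 := fun r hr => by
    by_contra! hcon
    exact absurd (hmin ⟨⟨hr.1, hr.2.le.trans hz.2⟩, hcon⟩) (not_le.2 hr.2)
  have hleft : ∀ᶠ r in nhdsWithin z (Iio z), r ∈ Ico a z := by
    filter_upwards [Ioo_mem_nhdsLT haz] with r hr using ⟨hr.1.le, hr.2⟩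
  have hDz0 : D z = 0 := by
    have hle : σ * D z ≤ 0 := by
      have hne : (nhdsWithin z (Ico a z)).NeBot := by
        rw [← mem_closure_iff_nhdsWithin_neBot, closure_Ico haz.ne]
        exact right_mem_Icc.2 haz.le
      have hlim : Tendsto (fun r => σ * D r) (nhdsWithin z (Ico a z)) (nhds (σ * D z)) :=
        (hcont z hz).mono fun r hr => ⟨hr.1, hr.2.le.trans hz.2⟩
      refine le_of_tendsto hlim ?_
      filter_upwards [self_mem_nhdsWithin] with r hr using (hlt r hr).le
    have := le_antisymm hle hDz
    simpa [hσ] using this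
  refine ⟨z, hz, hDz0, ?_⟩
  by_contra! hE
  have h1 := h.left z ⟨ha.trans haz, hz.2.trans hbd⟩ hDz0 (-σ) (by linarith)
  obtain ⟨r, hr1, hr2⟩ := (h1.and hleft).exists
  linarith [hlt r hr2]

theorem Transversal.alternatingZeros (h : Transversal D E c d)
    (hend : (-1) ^ n * D d ≤ 0) (hA : Alternates D d n) : ∃ z, AlternatingZeros D E c d n z := by
  obtain ⟨r, hr, hmono, hsign⟩ := hA
  have hex : ∀ i, ∃ z, i < n → (z ∈ Icc (r i) d ∧ (i + 1 < n → z ≤ r (i + 1))) ∧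
      D z = 0 ∧ (-1) ^ i * E z ≤ 0 := by
    intro i
    by_cases hi : i < n
    · by_cases hi' : i + 1 < n
      · obtain ⟨z, hz, h1, h2⟩ := h.exists_zero (σ := (-1) ^ i) (hr i hi).1 (hmono i hi').le
          (hr _ hi').2 (hsign i hi) (by have := hsign _ hi'; rw [pow_succ] at this; linarith)
        exact ⟨z, fun _ => ⟨⟨⟨hz.1, hz.2.trans (hr _ hi').2⟩, fun _ => hz.2⟩, h1, h2⟩⟩
      · obtain rfl : n = i + 1 := by omega
        obtain ⟨z, hz, h1, h2⟩ := h.exists_zero (σ := (-1) ^ i) (hr i hi).1 (hr i hi).2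
          le_rfl (hsign i hi) (by rw [pow_succ] at hend; linarith)
        exact ⟨z, fun _ => ⟨⟨hz, fun h => absurd h hi'⟩, h1, h2⟩⟩
    · exact ⟨0, fun h => absurd h hi⟩
  choose z hz using hex
  refine ⟨z, fun i hi => ⟨?_, (hz i hi).1.1.2⟩, fun i hi => ?_, fun i hi => (hz i hi).2.1,
    fun i hi => (hz i hi).2.2⟩
  · by_contra! hcon
    exact (h.neg (z i) ((hr i hi).1.trans_le (hz i hi).1.1.1) hcon.le).ne (hz i hi).2.1
  · exact ((hz i (by omega)).1.2 hi).trans (hz _ hi).1.1.1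

theorem Transversal.lt_of_alternatingZeros (h : Transversal D E c d) (hc : 0 < c) {z : ℕ → ℝ}
    (hB : AlternatingZeros D E c d n z) {i : ℕ} (hi : i + 1 < n) : z i < z (i + 1) := by
  obtain ⟨hz, hmono, hD, hE⟩ := hB
  refine lt_of_le_of_ne (hmono i hi) fun heq => ?_
  have h1 := hE _ hi
  have h2 := hE i (by omega)
  rw [← heq, pow_succ] at h1
  have h3 : (-1 : ℝ) ^ i * E (z i) = 0 := by linarith
  have hz' := hz i (by omega)
  exact h.ne (z i) ⟨hc.trans_le hz'.1, hz'.2⟩ (hD i (by omega)) (by simpa using h3)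

theorem Transversal.alternates (h : Transversal D E c d) (hc : 0 < c) {z : ℕ → ℝ}
    (hB : AlternatingZeros D E c d n z) : Alternates D d n := by
  have hlt := fun i hi => h.lt_of_alternatingZeros hc hB (i := i) hi
  obtain ⟨hz, -, hD, hE⟩ := hB
  have hzpos : ∀ i < n, z i ∈ Ioc 0 d := fun i hi => ⟨hc.trans_le (hz i hi).1, (hz i hi).2⟩
  have hex : ∀ i, ∃ r, i < n → (0 < r ∧ r < z i) ∧ (∀ j, j + 1 = i → z j < r) ∧
      (-1) ^ i * D r < 0 := by
    intro i
    by_cases hi : i < n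
    · have hE' : (-1) ^ i * E (z i) < 0 :=
        lt_of_le_of_ne (hE i hi) (by simpa using h.ne _ (hzpos i hi) (hD i hi))
      have h1 := h.left _ (hzpos i hi) (hD i hi) _ hE'
      have h2 : ∀ᶠ r in nhdsWithin (z i) (Iio (z i)), ∀ j, j + 1 = i → z j < r := by
        rcases i with _ | i
        · exact Eventually.of_forall fun r j hj => absurd hj (by omega)
        · filter_upwards [Ioo_mem_nhdsLT (hlt i hi)] with r hr j hj
          obtain rfl : j = i := by omega
          exact hr.1
      obtain ⟨r, hr1, hr2, hr3⟩ := (h1.and (h2.and (Ioo_mem_nhdsLT (hzpos i hi).1))).exists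
      exact ⟨r, fun _ => ⟨hr3, hr2, hr1⟩⟩
    · exact ⟨0, fun h => absurd h hi⟩
  choose r hr using hex
  exact ⟨r, fun i hi => ⟨(hr i hi).1.1, ((hr i hi).1.2.le.trans (hz i hi).2)⟩,
    fun i hi => ((hr i (by omega)).1.2).trans ((hr _ hi).2.1 i rfl), fun i hi => (hr i hi).2.2⟩

/-- A transversal function has boundedly many alternations. -/
theorem Transversal.exists_bound (h : Transversal D E c d) (hc : 0 < c) :
    ∃ N : ℕ, ∀ n, N < n → (-1) ^ n * D d ≤ 0 → ¬ Alternates D d n := by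
  have hfin : (Icc c d ∩ D ⁻¹' {0}).Finite := by
    by_contra hinf
    obtain ⟨x, hx, hacc⟩ := Set.Infinite.exists_accPt_of_subset_isCompact hinf isCompact_Icc
      inter_subset_left
    have hx' : x ∈ Ioc 0 d := ⟨hc.trans_le hx.1, hx.2⟩
    have hfreq := accPt_iff_frequently_nhdsNE.1 hacc
    have hDx : D x = 0 := by
      have hcl : IsClosed (Icc c d ∩ D ⁻¹' {0}) :=
        (h.cont.mono fun r hr => ⟨hc.trans_le hr.1, hr.2⟩).preimage_isClosed_of_isClosed
          isClosed_Icc isClosed_singleton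
      exact (hcl.closure_subset hacc.clusterPt.mem_closure).2
    obtain ⟨r, hr1, hr2⟩ := (hfreq.and_eventually (h.isolated x hx' hDx)).exists
    exact hr2 hr1.2
  refine ⟨hfin.toFinset.card, fun n hn hend hA => ?_⟩
  obtain ⟨z, hz⟩ := h.alternatingZeros hend hA
  have hlt : ∀ j < n, ∀ i < j, z i < z j := by
    intro j
    induction j with
    | zero => intro _ i hi; omega
    | succ j ih =>
      intro hj i hi
      have h1 := h.lt_of_alternatingZeros hc hz hj
      rcases Nat.lt_succ_iff_lt_or_eq.1 hi with h2 | rfl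
      · exact (ih (by omega) i h2).trans h1
      · exact h1
  have hle := Finset.card_le_card_of_injOn (s := Finset.range n) (t := hfin.toFinset) z
    (fun i hi => by
      have hi := Finset.mem_range.1 hi
      simpa using ⟨hz.1 i hi, hz.2.2.1 i hi⟩)
    (fun i hi j hj hij => by
      have hi := Finset.mem_range.1 (Finset.mem_coe.1 hi)
      have hj := Finset.mem_range.1 (Finset.mem_coe.1 hj)
      rcases lt_trichotomy i j with h1 | h1 | h1
      · exact absurd hij (hlt j hj i h1).ne
      · exact h1
      · exact absurd hij (hlt i hi j h1).ne')
  rw [Finset.card_range] at hle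
  omega

/-- Along a continuous family of transversal functions whose value at the end point keeps a weak
sign, alternations persist. -/
theorem alternates_of_family {D E : ℝ → ℝ → ℝ} {c d ρ₀ ρ₁ : ℝ} {n : ℕ} (hc : 0 < c)
    (hρ : ρ₀ ≤ ρ₁) (hT : ∀ ρ ∈ Icc ρ₀ ρ₁, Transversal (D ρ) (E ρ) c d)
    (hD : ContinuousOn (Function.uncurry D) (Icc ρ₀ ρ₁ ×ˢ Ioc 0 d))
    (hE : ContinuousOn (Function.uncurry E) (Icc ρ₀ ρ₁ ×ˢ Ioc 0 d))
    (hend : ∀ ρ ∈ Icc ρ₀ ρ₁, (-1) ^ n * D ρ d ≤ 0) (hA : Alternates (D ρ₁) d n) :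
    Alternates (D ρ₀) d n := by
  rcases Nat.eq_zero_or_pos n with rfl | hn
  · exact ⟨0, by simp, by simp, by simp⟩
  set K : Set (ℝ × (ℕ → ℝ)) := Icc ρ₀ ρ₁ ×ˢ univ.pi fun _ => Icc c d
  have hK : IsCompact K := isCompact_Icc.prod (isCompact_univ_pi fun _ => isCompact_Icc)
  have hmaps : ∀ i, MapsTo (fun p : ℝ × (ℕ → ℝ) => (p.1, p.2 i)) K (Icc ρ₀ ρ₁ ×ˢ Ioc 0 d) :=
    fun i p hp => ⟨hp.1, hc.trans_le (hp.2 i (mem_univ i)).1, (hp.2 i (mem_univ i)).2⟩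
  have hDi : ∀ i, ContinuousOn (fun p : ℝ × (ℕ → ℝ) => D p.1 (p.2 i)) K := fun i =>
    hD.comp (f := fun p : ℝ × (ℕ → ℝ) => (p.1, p.2 i)) (by fun_prop) (hmaps i)
  have hEi : ∀ i, ContinuousOn (fun p : ℝ × (ℕ → ℝ) => (-1) ^ i * E p.1 (p.2 i)) K := fun i =>
    continuousOn_const.mul
      (hE.comp (f := fun p : ℝ × (ℕ → ℝ) => (p.1, p.2 i)) (by fun_prop) (hmaps i))
  set Z : Set (ℝ × (ℕ → ℝ)) := K ∩ ⋂ i, (if i < n then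
    ((K ∩ (fun p => D p.1 (p.2 i)) ⁻¹' {0}) ∩ (K ∩ (fun p => (-1) ^ i * E p.1 (p.2 i)) ⁻¹' Iic 0))
      ∩ (if i + 1 < n then {p | p.2 i ≤ p.2 (i + 1)} else univ) else univ) with hZdef
  have hZ : IsCompact Z := by
    refine hK.inter_right (isClosed_iInter fun i => ?_)
    split_ifs
    · exact (((hDi i).preimage_isClosed_of_isClosed hK.isClosed isClosed_singleton).inter
        ((hEi i).preimage_isClosed_of_isClosed hK.isClosed isClosed_Iic)).inter
        (isClosed_le (by fun_prop) (by fun_prop))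
    · exact (((hDi i).preimage_isClosed_of_isClosed hK.isClosed isClosed_singleton).inter
        ((hEi i).preimage_isClosed_of_isClosed hK.isClosed isClosed_Iic)).inter isClosed_univ
    · exact isClosed_univ
  have hZmem : ∀ p ∈ Z, AlternatingZeros (D p.1) (E p.1) c d n p.2 := by
    intro p hp
    have hi : ∀ i < n, _ := fun i hi => by
      have := mem_iInter.1 hp.2 i
      rwa [if_pos hi] at this
    exact ⟨fun i _ => hp.1.2 i (mem_univ i), fun i h => by
      have := (hi i (by omega)).2
      rwa [if_pos h] at this, fun i h => (hi i h).1.1.2, fun i h => (hi i h).1.2.2⟩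
  have hS : ∀ ρ ∈ Icc ρ₀ ρ₁, Alternates (D ρ) d n → ρ ∈ Prod.fst '' Z := by
    intro ρ hρ hA
    obtain ⟨z, hz⟩ := (hT ρ hρ).alternatingZeros (hend ρ hρ) hA
    have hzK : ((ρ, fun i => if i < n then z i else z 0) : ℝ × (ℕ → ℝ)) ∈ K :=
      ⟨hρ, fun i _ => by
        by_cases h : i < n
        · simpa [h] using hz.1 i h
        · simpa [h] using hz.1 0 hn⟩
    refine ⟨(ρ, fun i => if i < n then z i else z 0), ⟨hzK, mem_iInter.2 fun i => ?_⟩, rfl⟩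
    by_cases h : i < n
    · rw [if_pos h]
      refine ⟨⟨⟨hzK, by simpa [h] using hz.2.2.1 i h⟩, hzK, by simpa [h] using hz.2.2.2 i h⟩, ?_⟩
      by_cases h' : i + 1 < n
      · simpa [h, h'] using hz.2.1 i h'
      · simp [h']
    · simp [h]
  obtain ⟨m, ⟨p, hpZ, rfl⟩, hmin⟩ := (hZ.image continuous_fst).exists_isLeast
    ⟨ρ₁, hS ρ₁ (right_mem_Icc.2 hρ) hA⟩
  have hp1 := hpZ.1.1
  have hAp := (hT _ hp1).alternates hc (hZmem p hpZ)
  rcases eq_or_lt_of_le hp1.1 with heq | hlt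
  · rwa [heq]
  exfalso
  obtain ⟨r, hr, hmono, hsign⟩ := hAp
  have hev : ∀ᶠ ρ in nhdsWithin p.1 (Icc ρ₀ ρ₁), ∀ i ∈ Finset.range n,
      (-1) ^ i * D ρ (r i) < 0 := by
    rw [eventually_all_finset]
    intro i hi
    have hi := Finset.mem_range.1 hi
    have hcont : ContinuousOn (fun ρ => (-1) ^ i * D ρ (r i)) (Icc ρ₀ ρ₁) :=
      continuousOn_const.mul
        (hD.comp (f := fun ρ => (ρ, r i)) (by fun_prop) fun ρ hρ => ⟨hρ, hr i hi⟩)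
    exact (hcont p.1 hp1).tendsto.eventually (gt_mem_nhds (hsign i hi))
  have hev' : ∀ᶠ ρ in nhdsWithin p.1 (Iio p.1), ρ ∈ Icc ρ₀ ρ₁ := by
    filter_upwards [Ioo_mem_nhdsLT hlt] with ρ hρ using ⟨hρ.1.le, hρ.2.le.trans hp1.2⟩
  have hle : nhdsWithin p.1 (Iio p.1) ≤ nhdsWithin p.1 (Icc ρ₀ ρ₁) :=
    le_inf inf_le_left (le_principal_iff.2 hev')
  obtain ⟨ρ, h1, h2, h3⟩ := ((hev.filter_mono hle).and (hev'.and self_mem_nhdsWithin)).exists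
  exact absurd (hmin (hS ρ h2 ⟨r, hr, hmono, fun i hi => h1 i (Finset.mem_range.2 hi)⟩))
    (not_le.2 h3)

end ZeroCounting

section RadialIntegrals

/-- The flux `∫₀ᵗ s^γ e^{h(s)} ds`. -/
noncomputable def flux (γ : ℝ) (h : ℝ → ℝ) (t : ℝ) : ℝ := ∫ s in (0:ℝ)..t, s ^ γ * exp (h s)

/-- The modulus of the derivative of a radial function with flux `flux γ h`. -/
noncomputable def slope (α γ b : ℝ) (h : ℝ → ℝ) (t : ℝ) : ℝ := t ^ (-(α * b)) * flux γ h t ^ b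

/-- The total decrease on `[0, r]` of a radial function with flux `flux γ h`. -/
noncomputable def drop (α γ b : ℝ) (h : ℝ → ℝ) (r : ℝ) : ℝ := ∫ t in (0:ℝ)..r, slope α γ b h t

variable {α γ b e H ε t r S : ℝ} {h h₁ h₂ : ℝ → ℝ}

theorem flux_intervalIntegrable (hγ : -1 < γ) (hh : Continuous h) (x y : ℝ) :
    IntervalIntegrable (fun s => s ^ γ * exp (h s)) volume x y :=
  (intervalIntegral.intervalIntegrable_rpow' hγ).mul_continuousOn
    (by fun_prop)

theorem continuous_flux (hγ : -1 < γ) (hh : Continuous h) : Continuous (flux γ h) :=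
  intervalIntegral.continuous_primitive (flux_intervalIntegrable hγ hh) 0

theorem hasDerivAt_flux (hγ : -1 < γ) (hh : Continuous h) (ht : 0 < t) :
    HasDerivAt (flux γ h) (t ^ γ * exp (h t)) t := by
  have hc : ContinuousOn (fun s : ℝ => s ^ γ * exp (h s)) (Ioi 0) := fun s hs =>
    ((continuousAt_rpow_const s γ (Or.inl (ne_of_gt hs))).mul
      (by fun_prop)).continuousWithinAt
  exact intervalIntegral.integral_hasDerivAt_right (flux_intervalIntegrable hγ hh 0 t)
    (hc.stronglyMeasurableAtFilter isOpen_Ioi t ht) (hc.continuousAt (Ioi_mem_nhds ht))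

@[simp] theorem flux_zero : flux γ h 0 = 0 := intervalIntegral.integral_same

theorem flux_mono (hγ : -1 < γ) (hh₁ : Continuous h₁) (hh₂ : Continuous h₂) (ht : 0 ≤ t)
    (hle : ∀ s ∈ Icc 0 t, h₁ s ≤ h₂ s) : flux γ h₁ t ≤ flux γ h₂ t :=
  intervalIntegral.integral_mono_on ht (flux_intervalIntegrable hγ hh₁ 0 t)
    (flux_intervalIntegrable hγ hh₂ 0 t) fun s hs =>
      mul_le_mul_of_nonneg_left (exp_le_exp.2 (hle s hs)) (rpow_nonneg hs.1 _)

theorem flux_congr (ht : 0 ≤ t) (hle : ∀ s ∈ Icc 0 t, h₁ s = h₂ s) :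
    flux γ h₁ t = flux γ h₂ t :=
  intervalIntegral.integral_congr fun s hs => by
    rw [uIcc_of_le ht] at hs
    simp only [hle s hs]

theorem flux_const_add (c : ℝ) : flux γ (fun s => c + h s) t = exp c * flux γ h t := by
  unfold flux
  rw [← intervalIntegral.integral_const_mul]
  congr 1
  ext
  rw [exp_add]
  ring

theorem flux_const (hγ : -1 < γ) : flux γ (fun _ => H) t = exp H * (t ^ (γ + 1) / (γ + 1)) := by
  unfold flux
  rw [intervalIntegral.integral_mul_const, integral_rpow (Or.inl hγ),
    zero_rpow (by linarith), sub_zero, mul_comm]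

theorem flux_pos (hγ : -1 < γ) (hh : Continuous h) (ht : 0 < t) : 0 < flux γ h t :=
  intervalIntegral.intervalIntegral_pos_of_pos_on (flux_intervalIntegrable hγ hh 0 t)
    (fun _ hs => mul_pos (rpow_pos_of_pos hs.1 _) (exp_pos _)) ht

theorem flux_le (hγ : -1 < γ) (hh : Continuous h) (ht : 0 ≤ t) (hH : ∀ s ∈ Icc 0 t, h s ≤ H) :
    flux γ h t ≤ exp H * (t ^ (γ + 1) / (γ + 1)) := by
  rw [← flux_const hγ]
  exact flux_mono hγ hh continuous_const ht hH

theorem flux_le_exp_mul (hγ : -1 < γ) (hh₁ : Continuous h₁) (hh₂ : Continuous h₂) (ht : 0 ≤ t)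
    (hle : ∀ s ∈ Icc 0 t, |h₁ s - h₂ s| ≤ ε) : flux γ h₁ t ≤ exp ε * flux γ h₂ t := by
  rw [← flux_const_add]
  exact flux_mono hγ hh₁ (by fun_prop) ht fun s hs => by
    linarith [le_abs_self (h₁ s - h₂ s), hle s hs]

theorem flux_sub_le (hγ : -1 < γ) (hh₁ : Continuous h₁) (hh₂ : Continuous h₂) (ht : 0 ≤ t)
    (hle : ∀ s ∈ Icc 0 t, |h₁ s - h₂ s| ≤ ε) (hε : 0 ≤ ε) (hH : ∀ s ∈ Icc 0 t, h₁ s ≤ H) :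
    flux γ h₁ t - flux γ h₂ t ≤ ε * (exp H * (t ^ (γ + 1) / (γ + 1))) := by
  have h1 := flux_le_exp_mul hγ hh₁ hh₂ ht hle
  have h2 : exp (-ε) * flux γ h₁ t ≤ flux γ h₂ t := by
    rw [exp_neg, inv_mul_le_iff₀ (exp_pos _)]
    exact h1
  have h3 := add_one_le_exp (-ε)
  have h4 := flux_le hγ hh₁ ht hH
  have h5 : 0 ≤ flux γ h₁ t := by
    rcases ht.eq_or_lt with rfl | ht
    · simp
    · exact (flux_pos hγ hh₁ ht).le
  nlinarith

theorem abs_flux_sub_le (hγ : -1 < γ) (hh₁ : Continuous h₁) (hh₂ : Continuous h₂) (ht : 0 ≤ t)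
    (hle : ∀ s ∈ Icc 0 t, |h₁ s - h₂ s| ≤ ε) (hε : 0 ≤ ε) (hH₁ : ∀ s ∈ Icc 0 t, h₁ s ≤ H)
    (hH₂ : ∀ s ∈ Icc 0 t, h₂ s ≤ H) :
    |flux γ h₁ t - flux γ h₂ t| ≤ ε * (exp H * (t ^ (γ + 1) / (γ + 1))) := by
  rw [abs_le]
  have h1 := flux_sub_le hγ hh₁ hh₂ ht hle hε hH₁
  have h2 := flux_sub_le hγ hh₂ hh₁ ht (fun s hs => by rw [abs_sub_comm]; exact hle s hs) hε hH₂
  constructor <;> linarith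

theorem slope_pos (hγ : -1 < γ) (hh : Continuous h) (ht : 0 < t) : 0 < slope α γ b h t :=
  mul_pos (rpow_pos_of_pos ht _) (rpow_pos_of_pos (flux_pos hγ hh ht) _)

theorem slope_le (hγ : -1 < γ) (hb : 0 < b) (he : e = (γ + 1 - α) * b + 1) (hh : Continuous h)
    (ht : 0 < t) (hH : ∀ s ∈ Icc 0 t, h s ≤ H) :
    slope α γ b h t ≤ (exp H / (γ + 1)) ^ b * t ^ (e - 1) := by
  have hγ' : 0 < γ + 1 := by linarith
  have h1 : flux γ h t ^ b ≤ (exp H / (γ + 1) * t ^ (γ + 1)) ^ b := by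
    refine rpow_le_rpow (flux_pos hγ hh ht).le ?_ hb.le
    have := flux_le hγ hh ht.le hH
    rwa [mul_div_assoc', ← div_mul_eq_mul_div] at this
  calc slope α γ b h t ≤ t ^ (-(α * b)) * (exp H / (γ + 1) * t ^ (γ + 1)) ^ b :=
        mul_le_mul_of_nonneg_left h1 (rpow_nonneg ht.le _)
    _ = (exp H / (γ + 1)) ^ b * (t ^ (-(α * b)) * t ^ ((γ + 1) * b)) := by
        rw [mul_rpow (by positivity) (by positivity), ← rpow_mul ht.le]; ring
    _ = _ := by rw [← rpow_add ht]; congr 2; rw [he]; ring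

theorem slope_sub_le (hγ : -1 < γ) (hb : 0 < b) (he : e = (γ + 1 - α) * b + 1)
    (hh₁ : Continuous h₁) (hh₂ : Continuous h₂) (ht : 0 < t)
    (hle : ∀ s ∈ Icc 0 t, |h₁ s - h₂ s| ≤ ε) (hε : 0 ≤ ε) (hH : ∀ s ∈ Icc 0 t, h₁ s ≤ H) :
    slope α γ b h₁ t - slope α γ b h₂ t ≤ b * ε * ((exp H / (γ + 1)) ^ b * t ^ (e - 1)) := by
  have h1 := flux_le_exp_mul hγ hh₁ hh₂ ht.le hle
  have h2 : flux γ h₁ t ^ b ≤ exp (b * ε) * flux γ h₂ t ^ b := by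
    rw [mul_comm b, exp_mul, ← mul_rpow (exp_pos _).le (flux_pos hγ hh₂ ht).le]
    exact rpow_le_rpow (flux_pos hγ hh₁ ht).le h1 hb.le
  have h3 : slope α γ b h₁ t ≤ exp (b * ε) * slope α γ b h₂ t := by
    unfold slope
    rw [mul_left_comm]
    exact mul_le_mul_of_nonneg_left h2 (rpow_nonneg ht.le _)
  have h4 : exp (-(b * ε)) * slope α γ b h₁ t ≤ slope α γ b h₂ t := by
    rw [exp_neg, inv_mul_le_iff₀ (exp_pos _)]
    exact h3
  have h5 := add_one_le_exp (-(b * ε))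
  have h6 := slope_le hγ hb he hh₁ ht hH
  have h7 := slope_pos (α := α) (b := b) hγ hh₁ ht
  have h8 : 0 ≤ b * ε := by positivity
  nlinarith

theorem continuousOn_slope (hγ : -1 < γ) (hh : Continuous h) :
    ContinuousOn (slope α γ b h) (Ioi 0) := fun t ht =>
  ((continuousAt_rpow_const t _ (Or.inl (ne_of_gt ht))).mul
    ((continuous_flux hγ hh).continuousAt.rpow_const
      (Or.inl (flux_pos hγ hh ht).ne'))).continuousWithinAt

theorem slope_intervalIntegrable (hγ : -1 < γ) (hb : 0 < b) (he : e = (γ + 1 - α) * b + 1)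
    (he0 : 0 < e) (hh : Continuous h) (hr : 0 ≤ r) :
    IntervalIntegrable (slope α γ b h) volume 0 r := by
  obtain ⟨H, hH⟩ := (isCompact_Icc (a := (0:ℝ)) (b := r)).bddAbove_image hh.continuousOn
  have hint : IntervalIntegrable (fun t : ℝ => (exp H / (γ + 1)) ^ b * t ^ (e - 1)) volume 0 r :=
    (intervalIntegral.intervalIntegrable_rpow' (by linarith)).const_mul _
  refine hint.mono_fun' ?_ ?_
  · rw [uIoc_of_le hr]
    exact ((continuousOn_slope hγ hh).mono fun t ht => ht.1).aestronglyMeasurable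
      measurableSet_Ioc
  · rw [uIoc_of_le hr]
    filter_upwards [ae_restrict_mem measurableSet_Ioc] with t ht
    rw [norm_of_nonneg (slope_pos hγ hh ht.1).le]
    exact slope_le hγ hb he hh ht.1 fun s hs => hH ⟨s, ⟨hs.1, hs.2.trans ht.2⟩, rfl⟩

theorem hasDerivAt_drop (hγ : -1 < γ) (hb : 0 < b) (he : e = (γ + 1 - α) * b + 1)
    (he0 : 0 < e) (hh : Continuous h) (hr : 0 < r) :
    HasDerivAt (drop α γ b h) (slope α γ b h r) r :=
  intervalIntegral.integral_hasDerivAt_right (slope_intervalIntegrable hγ hb he he0 hh hr.le)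
    ((continuousOn_slope hγ hh).stronglyMeasurableAtFilter isOpen_Ioi r hr)
    ((continuousOn_slope hγ hh).continuousAt (Ioi_mem_nhds hr))

@[simp] theorem drop_zero : drop α γ b h 0 = 0 := intervalIntegral.integral_same

theorem continuousOn_drop (hγ : -1 < γ) (hb : 0 < b) (he : e = (γ + 1 - α) * b + 1)
    (he0 : 0 < e) (hh : Continuous h) : ContinuousOn (drop α γ b h) (Ici 0) := by
  intro r hr
  have h1 : ContinuousOn (drop α γ b h) (uIcc 0 (r + 1)) :=
    intervalIntegral.continuousOn_primitive_interval
      ((intervalIntegrable_iff').1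
        (slope_intervalIntegrable hγ hb he he0 hh (by linarith [mem_Ici.1 hr])))
  rw [uIcc_of_le (by linarith [mem_Ici.1 hr])] at h1
  refine (h1 r ⟨hr, by linarith⟩).mono_of_mem_nhdsWithin ?_
  filter_upwards [self_mem_nhdsWithin, mem_nhdsWithin_of_mem_nhds (Iio_mem_nhds (lt_add_one r))]
    with s hs hs' using ⟨hs, le_of_lt hs'⟩

theorem drop_strictMonoOn (hγ : -1 < γ) (hb : 0 < b) (he : e = (γ + 1 - α) * b + 1)
    (he0 : 0 < e) (hh : Continuous h) : StrictMonoOn (drop α γ b h) (Ici 0) := by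
  refine strictMonoOn_of_deriv_pos (convex_Ici 0) (continuousOn_drop hγ hb he he0 hh) ?_
  intro r hr
  rw [interior_Ici] at hr
  rw [(hasDerivAt_drop hγ hb he he0 hh hr).deriv]
  exact slope_pos hγ hh hr

theorem drop_congr (hr : 0 ≤ r) (hle : ∀ s ∈ Icc 0 r, h₁ s = h₂ s) :
    drop α γ b h₁ r = drop α γ b h₂ r :=
  intervalIntegral.integral_congr fun s hs => by
    rw [uIcc_of_le hr] at hs
    simp only [slope, flux_congr hs.1 fun t ht => hle t ⟨ht.1, ht.2.trans hs.2⟩]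

/-- A continuous function on `[0, S]` is at most another one if this holds at `0` and for the
derivatives inside. -/
theorem le_of_hasDerivAt_le {y G y' G' : ℝ → ℝ} (hS : 0 ≤ S)
    (hyc : ContinuousOn y (Icc 0 S)) (hGc : ContinuousOn G (Icc 0 S))
    (hy : ∀ r ∈ Ioo 0 S, HasDerivAt y (y' r) r) (hG : ∀ r ∈ Ioo 0 S, HasDerivAt G (G' r) r)
    (hle : ∀ r ∈ Ioo 0 S, y' r ≤ G' r) (h0 : y 0 ≤ G 0) : y S ≤ G S := by
  have h := monotoneOn_of_deriv_nonneg (convex_Icc 0 S) (hGc.sub hyc)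
    (fun r hr => by
      rw [interior_Icc] at hr
      exact ((hG r hr).sub (hy r hr)).differentiableAt.differentiableWithinAt)
    (fun r hr => by
      rw [interior_Icc] at hr
      rw [((hG r hr).sub (hy r hr)).deriv]
      linarith [hle r hr]) (left_mem_Icc.2 hS) (right_mem_Icc.2 hS) hS
  simp only [Pi.sub_apply] at h
  linarith

theorem hasDerivAt_const_mul_rpow (he0 : 0 < e) (C : ℝ) (hr : 0 < r) :
    HasDerivAt (fun r => C / e * r ^ e) (C * r ^ (e - 1)) r :=
  ((Real.hasDerivAt_rpow_const (Or.inl hr.ne')).const_mul (C / e)).congr_deriv (by field_simp)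

theorem continuous_const_mul_rpow (he0 : 0 < e) (C : ℝ) :
    Continuous (fun r : ℝ => C / e * r ^ e) :=
  continuous_const.mul (continuous_rpow_const he0.le)

theorem drop_le (hγ : -1 < γ) (hb : 0 < b) (he : e = (γ + 1 - α) * b + 1)
    (he0 : 0 < e) (hh : Continuous h) (hr : 0 ≤ r) (hH : ∀ s ∈ Icc 0 r, h s ≤ H) :
    drop α γ b h r ≤ (exp H / (γ + 1)) ^ b / e * r ^ e :=
  le_of_hasDerivAt_le hr ((continuousOn_drop hγ hb he he0 hh).mono Icc_subset_Ici_self)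
    (continuous_const_mul_rpow he0 _).continuousOn
    (fun _ hs => hasDerivAt_drop hγ hb he he0 hh hs.1)
    (fun _ hs => hasDerivAt_const_mul_rpow he0 _ hs.1)
    (fun s hs => slope_le hγ hb he hh hs.1 fun x hx => hH x ⟨hx.1, hx.2.trans hs.2.le⟩)
    (by simp [zero_rpow he0.ne'])

theorem drop_sub_le (hγ : -1 < γ) (hb : 0 < b) (he : e = (γ + 1 - α) * b + 1)
    (he0 : 0 < e) (hh₁ : Continuous h₁) (hh₂ : Continuous h₂) (hr : 0 ≤ r)
    (hle : ∀ s ∈ Icc 0 r, |h₁ s - h₂ s| ≤ ε) (hε : 0 ≤ ε) (hH : ∀ s ∈ Icc 0 r, h₁ s ≤ H) :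
    drop α γ b h₁ r - drop α γ b h₂ r ≤ b * ε * (exp H / (γ + 1)) ^ b / e * r ^ e :=
  le_of_hasDerivAt_le (y := fun r => drop α γ b h₁ r - drop α γ b h₂ r) hr
    (((continuousOn_drop hγ hb he he0 hh₁).sub (continuousOn_drop hγ hb he he0 hh₂)).mono
      Icc_subset_Ici_self)
    (continuous_const_mul_rpow he0 _).continuousOn
    (fun _ hs => (hasDerivAt_drop hγ hb he he0 hh₁ hs.1).sub
      (hasDerivAt_drop hγ hb he he0 hh₂ hs.1))
    (fun _ hs => hasDerivAt_const_mul_rpow he0 _ hs.1)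
    (fun s hs => by
      rw [mul_assoc]
      exact slope_sub_le hγ hb he hh₁ hh₂ hs.1 (fun x hx => hle x ⟨hx.1, hx.2.trans hs.2.le⟩) hε
        fun x hx => hH x ⟨hx.1, hx.2.trans hs.2.le⟩)
    (by simp [zero_rpow he0.ne'])

theorem abs_drop_sub_le (hγ : -1 < γ) (hb : 0 < b) (he : e = (γ + 1 - α) * b + 1)
    (he0 : 0 < e) (hh₁ : Continuous h₁) (hh₂ : Continuous h₂) (hr : 0 ≤ r)
    (hle : ∀ s ∈ Icc 0 r, |h₁ s - h₂ s| ≤ ε) (hε : 0 ≤ ε) (hH₁ : ∀ s ∈ Icc 0 r, h₁ s ≤ H)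
    (hH₂ : ∀ s ∈ Icc 0 r, h₂ s ≤ H) :
    |drop α γ b h₁ r - drop α γ b h₂ r| ≤ b * ε * (exp H / (γ + 1)) ^ b / e * r ^ e := by
  rw [abs_le]
  have h1 := drop_sub_le hγ hb he he0 hh₁ hh₂ hr hle hε hH₁
  have h2 := drop_sub_le hγ hb he he0 hh₂ hh₁ hr
    (fun s hs => by rw [abs_sub_comm]; exact hle s hs) hε hH₂
  constructor <;> linarith

/-- Gronwall estimate for two solutions of the integral equation with comparable right-hand
sides. -/
theorem abs_sub_le_gronwall {y₁ y₂ : ℝ → ℝ} {ρ₁ ρ₂ L η : ℝ} (hγ : -1 < γ) (hb : 0 < b)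
    (he : e = (γ + 1 - α) * b + 1) (he0 : 0 < e) (hL : 0 < L) (hη : 0 ≤ η)
    (hh₁ : Continuous h₁) (hh₂ : Continuous h₂)
    (hy₁ : ∀ r, 0 ≤ r → y₁ r = ρ₁ - drop α γ b h₁ r)
    (hy₂ : ∀ r, 0 ≤ r → y₂ r = ρ₂ - drop α γ b h₂ r)
    (hH₁ : ∀ s ∈ Icc 0 S, h₁ s ≤ H) (hH₂ : ∀ s ∈ Icc 0 S, h₂ s ≤ H)
    (hle : ∀ s ∈ Icc 0 S, |h₁ s - h₂ s| ≤ L * |y₁ s - y₂ s| + η) :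
    ∀ r ∈ Icc 0 S, |y₁ r - y₂ r| ≤
      2 * (|ρ₁ - ρ₂| + η * (b * (exp H / (γ + 1)) ^ b / e * S ^ e)) *
        exp (2 * L * (b * (exp H / (γ + 1)) ^ b / e * S ^ e)) := by
  intro r₀ hr₀
  have hS : 0 ≤ S := hr₀.1.trans hr₀.2
  set C := b * (exp H / (γ + 1)) ^ b with hC
  have hC0 : 0 ≤ C := by
    have : 0 < γ + 1 := by linarith
    positivity
  have hyc₁ : ContinuousOn y₁ (Icc 0 S) := (continuousOn_const.sub
    ((continuousOn_drop hγ hb he he0 hh₁).mono Icc_subset_Ici_self)).congr fun r hr => hy₁ r hr.1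
  have hyc₂ : ContinuousOn y₂ (Icc 0 S) := (continuousOn_const.sub
    ((continuousOn_drop hγ hb he he0 hh₂).mono Icc_subset_Ici_self)).congr fun r hr => hy₂ r hr.1
  have hKc := continuous_const_mul_rpow he0 C
  obtain ⟨m, hm, hmax⟩ := (isCompact_Icc (a := (0:ℝ)) (b := S)).exists_isMaxOn
    ⟨0, left_mem_Icc.2 hS⟩
    (f := fun r => |y₁ r - y₂ r| * exp (-(2 * L * (C / e * r ^ e))))
    ((hyc₁.sub hyc₂).abs.mul (by fun_prop : Continuous fun r : ℝ =>
      exp (-(2 * L * (C / e * r ^ e)))).continuousOn)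
  set M := |y₁ m - y₂ m| * exp (-(2 * L * (C / e * m ^ e))) with hM
  have hM0 : 0 ≤ M := by positivity
  have hbound : ∀ r ∈ Icc 0 S, |y₁ r - y₂ r| ≤ M * exp (2 * L * (C / e * r ^ e)) := by
    intro r hr
    have h1 : |y₁ r - y₂ r| * exp (-(2 * L * (C / e * r ^ e))) ≤ M := hmax hr
    rwa [exp_neg, ← div_eq_mul_inv, div_le_iff₀ (exp_pos _)] at h1
  have hmonoK : ∀ s r : ℝ, 0 ≤ s → s ≤ r → C / e * s ^ e ≤ C / e * r ^ e := fun s r hs hsr => by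
    gcongr
  -- one-sided estimate, applied to both orderings
  have key : ∀ {h₁ h₂ y₁ y₂ : ℝ → ℝ} {ρ₁ ρ₂ : ℝ}, Continuous h₁ → Continuous h₂ →
      (∀ r, 0 ≤ r → y₁ r = ρ₁ - drop α γ b h₁ r) → (∀ r, 0 ≤ r → y₂ r = ρ₂ - drop α γ b h₂ r) →
      (∀ s ∈ Icc 0 S, h₂ s ≤ H) →
      (∀ s ∈ Icc 0 S, |h₂ s - h₁ s| ≤ L * (M * exp (2 * L * (C / e * s ^ e))) + η) →
      ∀ r ∈ Icc 0 S, y₁ r - y₂ r ≤ |ρ₁ - ρ₂| + M / 2 * exp (2 * L * (C / e * r ^ e))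
        + η * (C / e * r ^ e) := by
    intro h₁ h₂ y₁ y₂ ρ₁ ρ₂ hh₁ hh₂ hy₁ hy₂ hH₂ hle r hr
    have h := le_of_hasDerivAt_le (y := fun r => drop α γ b h₂ r - drop α γ b h₁ r)
      (G := fun r => M / 2 * exp (2 * L * (C / e * r ^ e)) + η * (C / e * r ^ e))
      (G' := fun r => M / 2 * (exp (2 * L * (C / e * r ^ e)) * (2 * L * (C * r ^ (e - 1))))
        + η * (C * r ^ (e - 1))) hr.1
      (((continuousOn_drop hγ hb he he0 hh₂).sub (continuousOn_drop hγ hb he he0 hh₁)).mono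
        Icc_subset_Ici_self) (by fun_prop)
      (fun _ hs => (hasDerivAt_drop hγ hb he he0 hh₂ hs.1).sub
        (hasDerivAt_drop hγ hb he he0 hh₁ hs.1))
      (fun s hs => by
        have h1 := hasDerivAt_const_mul_rpow he0 C hs.1
        exact ((h1.const_mul (2 * L)).exp.const_mul (M / 2)).add (h1.const_mul η))
      (fun s hs => by
        have h1 := slope_sub_le (α := α) hγ hb he hh₂ hh₁ hs.1 (H := H)
          (ε := L * (M * exp (2 * L * (C / e * s ^ e))) + η)
          (fun x hx => (hle x ⟨hx.1, hx.2.trans (hs.2.le.trans hr.2)⟩).trans (by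
            have := hmonoK x s hx.1 hx.2
            gcongr)) (by positivity)
          (fun x hx => hH₂ x ⟨hx.1, hx.2.trans (hs.2.le.trans hr.2)⟩)
        refine h1.trans (le_of_eq ?_)
        rw [hC]
        ring)
      (by simpa [zero_rpow he0.ne'] using by positivity)
    rw [hy₁ r hr.1, hy₂ r hr.1]
    linarith [le_abs_self (ρ₁ - ρ₂)]
  have hle' : ∀ s ∈ Icc 0 S, |h₁ s - h₂ s| ≤ L * (M * exp (2 * L * (C / e * s ^ e))) + η :=
    fun s hs => (hle s hs).trans (by have := hbound s hs; gcongr)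
  have habs : ∀ r ∈ Icc 0 S, |y₁ r - y₂ r| ≤
      |ρ₁ - ρ₂| + M / 2 * exp (2 * L * (C / e * r ^ e)) + η * (C / e * r ^ e) := fun r hr => by
    have h1 := key hh₁ hh₂ hy₁ hy₂ hH₂ (fun s hs => by rw [abs_sub_comm]; exact hle' s hs) r hr
    have h2 := key hh₂ hh₁ hy₂ hy₁ hH₁ hle' r hr
    rw [abs_sub_comm ρ₂] at h2
    rw [abs_le]
    constructor <;> linarith
  have hMle : M ≤ 2 * (|ρ₁ - ρ₂| + η * (C / e * S ^ e)) := by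
    have h1 := habs m hm
    have h2 : |y₁ m - y₂ m| = M * exp (2 * L * (C / e * m ^ e)) := by
      rw [hM, mul_assoc, ← exp_add]; simp
    have h3 : 1 ≤ exp (2 * L * (C / e * m ^ e)) := by
      have : 0 ≤ m ^ e := rpow_nonneg hm.1 _
      exact one_le_exp (by positivity)
    have h4 : η * (C / e * m ^ e) ≤ η * (C / e * S ^ e) := by
      have := hmonoK m S hm.1 hm.2
      gcongr
    have h5 : 0 ≤ |ρ₁ - ρ₂| + η * (C / e * S ^ e) := by
      have : 0 ≤ S ^ e := rpow_nonneg hS _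
      positivity
    rw [h2] at h1
    nlinarith
  calc |y₁ r₀ - y₂ r₀| ≤ M * exp (2 * L * (C / e * r₀ ^ e)) := hbound r₀ hr₀
    _ ≤ _ := by
      have := hmonoK r₀ S hr₀.1 hr₀.2
      gcongr

end RadialIntegrals

section SlowVariation

/-- Additively slow variation at infinity, locally uniformly. -/
def SlowlyVarying (G : ℝ → ℝ) : Prop :=
  ∀ H ε : ℝ, 0 < ε → ∀ᶠ t in atTop, ∀ s, |s - t| ≤ H → |G s - G t| ≤ ε * G t

theorem slowlyVarying_of_tendsto {G : ℝ → ℝ} (hpos : ∀ᶠ t in atTop, 0 < G t)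
    (hA : ∀ h : ℝ → ℝ, (h =o[atTop] fun t : ℝ => t) →
      Tendsto (fun t => G t / G (t + h t)) atTop (nhds 1)) : SlowlyVarying G := by
  classical
  intro H ε hε
  by_contra hcon
  rw [not_eventually] at hcon
  set h : ℝ → ℝ := fun t => if hx : ∃ s, |s - t| ≤ H ∧ ε * G t < |G s - G t|
    then hx.choose - t else 0 with hh
  have hspec : ∀ t, (∃ s, |s - t| ≤ H ∧ ε * G t < |G s - G t|) →
      |h t| ≤ H ∧ ε * G t < |G (t + h t) - G t| := by
    intro t ht
    have : h t = ht.choose - t := dif_pos ht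
    rw [this, add_sub_cancel]
    exact ht.choose_spec
  have hbdd : h =O[atTop] fun _ => (1 : ℝ) := by
    refine IsBigO.of_bound (max H 0) (Eventually.of_forall fun t => ?_)
    rw [norm_one, mul_one, norm_eq_abs]
    by_cases ht : ∃ s, |s - t| ≤ H ∧ ε * G t < |G s - G t|
    · exact (hspec t ht).1.trans (le_max_left _ _)
    · have : h t = 0 := dif_neg ht
      rw [this, abs_zero]
      exact le_max_right _ _
  have hlim := hA h (hbdd.trans_isLittleO (isLittleO_const_id_atTop 1))
  have hlim' : Tendsto (fun t => G (t + h t) / G t) atTop (nhds 1) := by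
    simpa using hlim.inv₀ one_ne_zero
  have hev := (Metric.tendsto_nhds.1 hlim' ε hε).and hpos
  obtain ⟨t, ht, h1, h2⟩ := (hcon.and_eventually hev).exists
  push Not at ht
  have h3 := (hspec t ht).2
  rw [Real.dist_eq, div_sub_one h2.ne', abs_div, abs_of_pos h2, div_lt_iff₀ h2] at h1
  linarith

section Tail

variable {Φ G : ℝ → ℝ} {b T₀ : ℝ}

theorem tail_step (hb : 0 < b) (hΦ : ∀ t, T₀ ≤ t → HasDerivAt Φ (-(exp (-(b * t)) * G t)) t)
    {t m : ℝ} (ht : T₀ ≤ t) :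
    ((∀ s ∈ Icc t (t + 1), G s ≤ m) →
      Φ t - Φ (t + 1) ≤ m * (exp (-(b * t)) / b) * (1 - exp (-b))) ∧
    ((∀ s ∈ Icc t (t + 1), m ≤ G s) →
      m * (exp (-(b * t)) / b) * (1 - exp (-b)) ≤ Φ t - Φ (t + 1)) := by
  have hle : t ≤ t + 1 := by linarith
  have hd : ∀ s ∈ Icc t (t + 1), HasDerivAt (fun s => Φ s - m * (exp (-(b * s)) / b))
      (exp (-(b * s)) * (m - G s)) s := by
    intro s hs
    have h1 : HasDerivAt (fun s => exp (-(b * s))) (exp (-(b * s)) * (-(b * 1))) s :=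
      ((hasDerivAt_id s).const_mul b).neg.exp
    refine ((hΦ s (ht.trans hs.1)).sub ((h1.div_const b).const_mul m)).congr_deriv ?_
    field_simp
    ring
  have hexp : exp (-(b * (t + 1))) = exp (-(b * t)) * exp (-b) := by
    rw [← exp_add]; congr 1; ring
  have hcont : ContinuousOn (fun s => Φ s - m * (exp (-(b * s)) / b)) (Icc t (t + 1)) :=
    fun s hs => (hd s hs).continuousAt.continuousWithinAt
  have hdiff : DifferentiableOn ℝ (fun s => Φ s - m * (exp (-(b * s)) / b))
      (interior (Icc t (t + 1))) :=
    fun s hs => (hd s (interior_subset hs)).differentiableAt.differentiableWithinAt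
  constructor
  · intro hG
    have h := monotoneOn_of_deriv_nonneg (convex_Icc t (t + 1)) hcont hdiff (fun s hs => by
      rw [(hd s (interior_subset hs)).deriv]
      exact mul_nonneg (exp_pos _).le (sub_nonneg.2 (hG s (interior_subset hs))))
      (left_mem_Icc.2 hle) (right_mem_Icc.2 hle) hle
    simp only [hexp] at h
    have : m * (exp (-(b * t)) / b) * (1 - exp (-b)) =
      m * (exp (-(b * t)) / b) - m * (exp (-(b * t)) * exp (-b) / b) := by ring
    linarith
  · intro hG
    have h := antitoneOn_of_deriv_nonpos (convex_Icc t (t + 1)) hcont hdiff (fun s hs => by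
      rw [(hd s (interior_subset hs)).deriv]
      exact mul_nonpos_of_nonneg_of_nonpos (exp_pos _).le
        (sub_nonpos.2 (hG s (interior_subset hs))))
      (left_mem_Icc.2 hle) (right_mem_Icc.2 hle) hle
    simp only [hexp] at h
    have : m * (exp (-(b * t)) / b) * (1 - exp (-b)) =
      m * (exp (-(b * t)) / b) - m * (exp (-(b * t)) * exp (-b) / b) := by ring
    linarith

theorem nonneg_of_step {X : ℝ → ℝ} (hX : Tendsto X atTop (nhds 0)) {T : ℝ}
    (hstep : ∀ t, T ≤ t → X (t + 1) ≤ X t) {t : ℝ} (ht : T ≤ t) : 0 ≤ X t := by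
  have hn : ∀ n : ℕ, X (t + n) ≤ X t := by
    intro n
    induction n with
    | zero => simp
    | succ n ih =>
      have h := hstep (t + n) (by have : (0:ℝ) ≤ n := n.cast_nonneg
                                  linarith)
      push_cast
      rw [← add_assoc]
      exact h.trans ih
  exact le_of_tendsto (hX.comp (tendsto_atTop_add_const_left atTop t tendsto_natCast_atTop_atTop))
    (Eventually.of_forall hn)

theorem tendsto_weight (hb : 0 < b) (hG : SlowlyVarying G)
    (hGpos : ∀ t, T₀ ≤ t → 0 < G t)
    (hΦ : ∀ t, T₀ ≤ t → HasDerivAt Φ (-(exp (-(b * t)) * G t)) t)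
    (hΦ0 : Tendsto Φ atTop (nhds 0)) :
    Tendsto (fun t => exp (-(b * t)) * G t) atTop (nhds 0) := by
  have hq : 0 < 1 - exp (-b) := by simpa using hb
  have hlim : Tendsto (fun t => (Φ t - Φ (t + 1)) * (2 * b / (1 - exp (-b)))) atTop (nhds 0) := by
    simpa using (hΦ0.sub (hΦ0.comp (tendsto_atTop_add_const_right atTop 1 tendsto_id))).mul_const
      (2 * b / (1 - exp (-b)))
  refine tendsto_of_tendsto_of_tendsto_of_le_of_le' tendsto_const_nhds hlim ?_ ?_
  · filter_upwards [eventually_ge_atTop T₀] with t ht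
    exact (mul_pos (exp_pos _) (hGpos t ht)).le
  · filter_upwards [eventually_ge_atTop T₀, hG 1 (1 / 2) (by norm_num)] with t ht hGt
    have h1 := (tail_step hb hΦ ht (m := G t / 2)).2 fun s hs => by
      have := hGt s (by rw [abs_of_nonneg] <;> linarith [hs.1, hs.2])
      linarith [(abs_le.1 this).1]
    rw [mul_div_assoc', le_div_iff₀ hq]
    have h2 : G t / 2 * (exp (-(b * t)) / b) * (1 - exp (-b)) * (2 * b) =
      exp (-(b * t)) * G t * (1 - exp (-b)) := by field_simp
    nlinarith

/-- The tail function is asymptotic to its weight. -/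
theorem tendsto_tail_div (hb : 0 < b) (hG : SlowlyVarying G)
    (hGpos : ∀ t, T₀ ≤ t → 0 < G t)
    (hΦ : ∀ t, T₀ ≤ t → HasDerivAt Φ (-(exp (-(b * t)) * G t)) t)
    (hΦ0 : Tendsto Φ atTop (nhds 0)) :
    Tendsto (fun t => Φ t / (exp (-(b * t)) * G t)) atTop (nhds (1 / b)) := by
  have hA0 := tendsto_weight hb hG hGpos hΦ hΦ0
  set q := exp (-b) with hqdef
  have hq0 : 0 < q := exp_pos _
  have hq1 : q < 1 := by simpa [hqdef] using hb
  have hexp : ∀ t, exp (-(b * (t + 1))) = exp (-(b * t)) * q := fun t => by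
    rw [hqdef, ← exp_add]; congr 1; ring
  have hmem : ∀ t s : ℝ, s ∈ Icc t (t + 1) → |s - t| ≤ 1 := fun t s hs => by
    rw [abs_of_nonneg] <;> linarith [hs.1, hs.2]
  have hpos : ∀ t, T₀ ≤ t → 0 < exp (-(b * t)) * G t := fun t ht =>
    mul_pos (exp_pos _) (hGpos t ht)
  have hdiff0 : ∀ c : ℝ, Tendsto (fun t => Φ t - c * (exp (-(b * t)) * G t)) atTop (nhds 0) :=
    fun c => by simpa using hΦ0.sub (hA0.const_mul c)
  rw [tendsto_order]
  constructor
  · intro l hl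
    have hbl : b * l < 1 := by rw [lt_div_iff₀ hb] at hl; linarith
    obtain ⟨μ, hμ1, hμ2⟩ := exists_between (max_lt hbl one_pos)
    have hμ0 : 0 < μ := (le_max_right _ _).trans_lt hμ1
    have hden : 0 < 1 - q + μ * q := by nlinarith
    set ε := (1 - μ) * (1 - q) / (1 - q + μ * q) with hε
    have hε0 : 0 < ε := div_pos (mul_pos (by linarith) (by linarith)) hden
    have hεeq : (1 - ε) * (1 - q) = μ * (1 - (1 - ε) * q) := by
      have : ε * (1 - q + μ * q) = (1 - μ) * (1 - q) := by rw [hε]; field_simp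
      linarith
    obtain ⟨T, hT⟩ := eventually_atTop.1 (hG 1 ε hε0)
    have key : ∀ t, max T T₀ ≤ t → 0 ≤ Φ t - μ / b * (exp (-(b * t)) * G t) := fun t ht =>
      nonneg_of_step (hdiff0 (μ / b)) (T := max T T₀) (fun t ht => by
        have hsv := hT t ((le_max_left _ _).trans ht)
        have ht0 := (le_max_right _ _).trans ht
        have h1 := (tail_step hb hΦ ht0 (m := (1 - ε) * G t)).2 fun s hs => by
          linarith [(abs_le.1 (hsv s (hmem t s hs))).1]
        have h2 : (1 - ε) * G t ≤ G (t + 1) := by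
          linarith [(abs_le.1 (hsv (t + 1) (by simp))).1]
        rw [hexp]
        have h3 : (1 - ε) * G t * (exp (-(b * t)) / b) * (1 - q) =
          μ / b * (exp (-(b * t)) * G t) - μ / b * (exp (-(b * t)) * q * ((1 - ε) * G t)) := by
          linear_combination (exp (-(b * t)) / b * G t) * hεeq
        have h4 : μ / b * (exp (-(b * t)) * q * ((1 - ε) * G t)) ≤
          μ / b * (exp (-(b * t)) * q * G (t + 1)) := by gcongr
        linarith) ht
    filter_upwards [eventually_ge_atTop (max T T₀)] with t ht
    rw [lt_div_iff₀ (hpos t ((le_max_right _ _).trans ht))]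
    have h1 := key t ht
    have h2 : l < μ / b := by
      rw [lt_div_iff₀ hb]; linarith [(le_max_left (b * l) 0).trans_lt hμ1]
    nlinarith [hpos t ((le_max_right _ _).trans ht)]
  · intro l hl
    obtain ⟨μ, hμ1, hμ2⟩ := exists_between (show 1 < b * l by
      rw [gt_iff_lt, div_lt_iff₀ hb] at hl; linarith)
    have hden : 0 < 1 - q + μ * q := by nlinarith
    set ε := (μ - 1) * (1 - q) / (1 - q + μ * q) with hε
    have hε0 : 0 < ε := div_pos (mul_pos (by linarith) (by linarith)) hden
    have hεeq : (1 + ε) * (1 - q) = μ * (1 - (1 + ε) * q) := by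
      have : ε * (1 - q + μ * q) = (μ - 1) * (1 - q) := by rw [hε]; field_simp
      linarith
    obtain ⟨T, hT⟩ := eventually_atTop.1 (hG 1 ε hε0)
    have key : ∀ t, max T T₀ ≤ t → 0 ≤ -(Φ t - μ / b * (exp (-(b * t)) * G t)) := fun t ht =>
      nonneg_of_step (X := fun t => -(Φ t - μ / b * (exp (-(b * t)) * G t))) (T := max T T₀)
        (by simpa using (hdiff0 (μ / b)).neg) (fun t ht => by
        have hsv := hT t ((le_max_left _ _).trans ht)
        have ht0 := (le_max_right _ _).trans ht
        have h1 := (tail_step hb hΦ ht0 (m := (1 + ε) * G t)).1 fun s hs => by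
          linarith [(abs_le.1 (hsv s (hmem t s hs))).2]
        have h2 : G (t + 1) ≤ (1 + ε) * G t := by
          linarith [(abs_le.1 (hsv (t + 1) (by simp))).2]
        rw [hexp]
        have h3 : (1 + ε) * G t * (exp (-(b * t)) / b) * (1 - q) =
          μ / b * (exp (-(b * t)) * G t) - μ / b * (exp (-(b * t)) * q * ((1 + ε) * G t)) := by
          linear_combination (exp (-(b * t)) / b * G t) * hεeq
        have h4 : μ / b * (exp (-(b * t)) * q * G (t + 1)) ≤
          μ / b * (exp (-(b * t)) * q * ((1 + ε) * G t)) := by gcongr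
        linarith) ht
    filter_upwards [eventually_ge_atTop (max T T₀)] with t ht
    rw [div_lt_iff₀ (hpos t ((le_max_right _ _).trans ht))]
    have h1 := key t ht
    have h2 : μ / b < l := by
      rw [div_lt_iff₀ hb]; linarith
    nlinarith [hpos t ((le_max_right _ _).trans ht)]

theorem tendsto_tail_shift_div (hb : 0 < b) (hG : SlowlyVarying G)
    (hGpos : ∀ t, T₀ ≤ t → 0 < G t)
    (hΦ : ∀ t, T₀ ≤ t → HasDerivAt Φ (-(exp (-(b * t)) * G t)) t)
    (hΦ0 : Tendsto Φ atTop (nhds 0)) (y : ℝ) :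
    Tendsto (fun t => Φ (t + y) / (exp (-(b * t)) * G t)) atTop (nhds (exp (-(b * y)) / b)) := by
  have h1 := (tendsto_tail_div hb hG hGpos hΦ hΦ0).comp
    (tendsto_atTop_add_const_right atTop y tendsto_id)
  have h2 : Tendsto (fun t => G (t + y) / G t) atTop (nhds 1) := by
    rw [Metric.tendsto_nhds]
    intro ε hε
    filter_upwards [hG |y| (ε / 2) (half_pos hε), eventually_ge_atTop T₀] with t ht ht0
    have h3 := ht (t + y) (by simp)
    have h4 := hGpos t ht0
    rw [Real.dist_eq, div_sub_one h4.ne', abs_div, abs_of_pos h4, div_lt_iff₀ h4]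
    nlinarith
  have h3 := (h1.mul h2).mul_const (exp (-(b * y)))
  rw [mul_one, one_div_mul_eq_div] at h3
  refine h3.congr' ?_
  filter_upwards [eventually_ge_atTop T₀, eventually_ge_atTop (T₀ - y)] with t ht hty
  have h4 := hGpos t ht
  have h5 := hGpos (t + y) (by linarith)
  simp only [Function.comp_apply, id_eq]
  have h6 : exp (-(b * (t + y))) = exp (-(b * t)) * exp (-(b * y)) := by
    rw [← exp_add]; congr 1; ring
  rw [h6]
  field_simp

end Tail

end SlowVariation

/-- A smooth increasing unbounded function `f` on the half-line with inverse `g`. -/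
structure IsProfile (f g : ℝ → ℝ) : Prop where
  contDiffOn : ContDiffOn ℝ 4 f (Ici 0)
  deriv_pos : ∀ x ∈ Ici (0:ℝ), 0 < deriv f x
  tendsto : Tendsto f atTop atTop
  left_inv : ∀ x ∈ Ici (0:ℝ), g (f x) = x

/-- The function `f`, frozen to the left of the origin. -/
def clip (f : ℝ → ℝ) (x : ℝ) : ℝ := f (max x 0)

/-- The tail integral of `exp (-(b * f))`. -/
noncomputable def tail (b : ℝ) (f : ℝ → ℝ) (x : ℝ) : ℝ := ∫ s in Ici x, exp (-(b * f s))

theorem clip_of_nonneg {f : ℝ → ℝ} {x : ℝ} (hx : 0 ≤ x) : clip f x = f x := by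
  rw [clip, max_eq_left hx]

namespace IsProfile

variable {f g : ℝ → ℝ} {b : ℝ}

theorem differentiableAt (h : IsProfile f g) {x : ℝ} (hx : 0 ≤ x) : DifferentiableAt ℝ f x :=
  differentiableAt_of_deriv_ne_zero (h.deriv_pos x hx).ne'

theorem continuousOn (h : IsProfile f g) : ContinuousOn f (Ici 0) := h.contDiffOn.continuousOn

theorem strictMonoOn (h : IsProfile f g) : StrictMonoOn f (Ici 0) :=
  strictMonoOn_of_deriv_pos (convex_Ici 0) h.continuousOn fun x hx =>
    h.deriv_pos x (interior_subset hx)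

theorem exists_eq (h : IsProfile f g) {t : ℝ} (ht : f 0 ≤ t) : ∃ x, 0 ≤ x ∧ f x = t := by
  obtain ⟨X, hX0, hX⟩ := ((eventually_ge_atTop (0:ℝ)).and (h.tendsto.eventually_ge_atTop t)).exists
  obtain ⟨x, hx, hxt⟩ := intermediate_value_Icc hX0 (h.continuousOn.mono Icc_subset_Ici_self)
    ⟨ht, hX⟩
  exact ⟨x, hx.1, hxt⟩

theorem inv_nonneg (h : IsProfile f g) {t : ℝ} (ht : f 0 ≤ t) : 0 ≤ g t := by
  obtain ⟨x, hx, rfl⟩ := h.exists_eq ht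
  rwa [h.left_inv x hx]

theorem right_inv (h : IsProfile f g) {t : ℝ} (ht : f 0 ≤ t) : f (g t) = t := by
  obtain ⟨x, hx, rfl⟩ := h.exists_eq ht
  rw [h.left_inv x hx]

theorem inv_strictMonoOn (h : IsProfile f g) : StrictMonoOn g (Ici (f 0)) := by
  intro s hs t ht hst
  rw [← h.strictMonoOn.lt_iff_lt (h.inv_nonneg hs) (h.inv_nonneg ht), h.right_inv hs,
    h.right_inv ht]
  exact hst

theorem inv_pos (h : IsProfile f g) {t : ℝ} (ht : f 0 < t) : 0 < g t :=
  (h.inv_nonneg le_rfl).trans_lt (h.inv_strictMonoOn self_mem_Ici ht.le ht)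

theorem hasDerivAt_inv (h : IsProfile f g) {t : ℝ} (ht : f 0 < t) :
    HasDerivAt g (deriv f (g t))⁻¹ t := by
  have himg : g '' Ici (f 0) ∈ nhds (g t) := by
    refine mem_of_superset (Ioi_mem_nhds (h.inv_pos ht)) fun x hx => ?_
    have hx0 : (0:ℝ) ≤ x := le_of_lt hx
    exact ⟨f x, h.strictMonoOn.monotoneOn self_mem_Ici hx0 hx0, h.left_inv x hx0⟩
  refine HasDerivAt.of_local_left_inverse
    (h.inv_strictMonoOn.continuousAt_of_image_mem_nhds (Ici_mem_nhds ht) himg)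
    (h.differentiableAt (h.inv_pos ht).le).hasDerivAt (h.deriv_pos _ (h.inv_pos ht).le).ne' ?_
  filter_upwards [Ioi_mem_nhds ht] with s hs using h.right_inv (le_of_lt hs)

theorem deriv_inv_pos (h : IsProfile f g) {t : ℝ} (ht : f 0 < t) : 0 < deriv g t := by
  rw [(h.hasDerivAt_inv ht).deriv]
  exact _root_.inv_pos.2 (h.deriv_pos _ (h.inv_pos ht).le)

theorem hasDerivAt_inv' (h : IsProfile f g) {t : ℝ} (ht : f 0 < t) :
    HasDerivAt g (deriv g t) t := (h.hasDerivAt_inv ht).differentiableAt.hasDerivAt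

theorem continuous_clip (h : IsProfile f g) : Continuous (clip f) :=
  h.continuousOn.comp_continuous (continuous_id.max continuous_const) fun _ =>
    mem_Ici.2 (le_max_right _ _)

theorem monotone_clip (h : IsProfile f g) : Monotone (clip f) := fun _ _ hxy =>
  h.strictMonoOn.monotoneOn (mem_Ici.2 (le_max_right _ _)) (mem_Ici.2 (le_max_right _ _))
    (max_le_max_right 0 hxy)

theorem clip_lipschitz (h : IsProfile f g) (H : ℝ) :
    ∃ L, 0 < L ∧ ∀ x y, x ≤ H → y ≤ H → |clip f x - clip f y| ≤ L * |x - y| := by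
  obtain ⟨K, hK⟩ := (h.contDiffOn.mono
    (Icc_subset_Ici_self : Icc 0 (max H 0) ⊆ Ici 0)).exists_lipschitzOnWith
    (by norm_num) (convex_Icc 0 (max H 0)) isCompact_Icc
  refine ⟨K + 1, by positivity, fun x y hx hy => ?_⟩
  have h1 := hK.dist_le_mul (max x 0) ⟨le_max_right _ _, max_le_max_right 0 hx⟩
    (max y 0) ⟨le_max_right _ _, max_le_max_right 0 hy⟩
  have h2 := abs_max_sub_max_le_abs x y 0
  rw [Real.dist_eq, Real.dist_eq] at h1
  have h3 : (K:ℝ) * |max x 0 - max y 0| ≤ K * |x - y| := by gcongr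
  have h4 := abs_nonneg (x - y)
  unfold clip
  linarith

theorem abs_inv_add_sub_le (h : IsProfile f g) (hG : SlowlyVarying (deriv g)) (H : ℝ) {ε : ℝ}
    (hε : 0 < ε) : ∀ᶠ t in atTop, ∀ y, |y| ≤ H →
      |g (t + y) - g t - y * deriv g t| ≤ ε * deriv g t * |y| := by
  filter_upwards [hG H ε hε, eventually_gt_atTop (f 0 + H)] with t ht htH y hy
  have hH : 0 ≤ H := (abs_nonneg y).trans hy
  have hd : ∀ s ∈ Icc (t - H) (t + H), HasDerivWithinAt (fun s => g s - s * deriv g t)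
      (deriv g s - deriv g t) (Icc (t - H) (t + H)) s := fun s hs =>
    (((h.hasDerivAt_inv' (by linarith [hs.1])).sub
      ((hasDerivAt_id s).mul_const (deriv g t))).congr_deriv (by simp)).hasDerivWithinAt
  have h1 := (convex_Icc (t - H) (t + H)).norm_image_sub_le_of_norm_hasDerivWithin_le hd
    (C := ε * deriv g t)
    (fun s hs => ht s (abs_le.2 ⟨by linarith [hs.1], by linarith [hs.2]⟩))
    (show t ∈ Icc (t - H) (t + H) from ⟨by linarith, by linarith⟩)
    (show t + y ∈ Icc (t - H) (t + H) from
      ⟨by linarith [(abs_le.1 hy).1], by linarith [(abs_le.1 hy).2]⟩)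
  simp only [norm_eq_abs, add_sub_cancel_left] at h1
  convert h1 using 2
  ring

/-- After rescaling by the derivative of the inverse, the profile becomes linear. -/
theorem clip_linearization (h : IsProfile f g) (hG : SlowlyVarying (deriv g)) {W ε : ℝ}
    (hW : 0 ≤ W) (hε : 0 < ε) : ∀ᶠ t in atTop, ∀ w ∈ Icc (-W) 0,
      |clip f (g t + w * deriv g t) - t - w| ≤ ε := by
  have hH : 0 < W + ε := by linarith
  filter_upwards [h.abs_inv_add_sub_le hG (W + ε) (div_pos hε hH),
    eventually_gt_atTop (f 0 + (W + ε))] with t ht htH w hw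
  have hGt := h.deriv_inv_pos (show f 0 < t by linarith)
  have hbound : ∀ y, |y| ≤ W + ε → |g (t + y) - g t - y * deriv g t| ≤ ε * deriv g t := by
    intro y hy
    refine (ht y hy).trans ?_
    rw [div_mul_eq_mul_div, div_mul_eq_mul_div, div_le_iff₀ hH]
    exact mul_le_mul_of_nonneg_left hy (mul_pos hε hGt).le
  have h1 := abs_le.1 (hbound (w + ε) (abs_le.2 ⟨by linarith [hw.1], by linarith [hw.2]⟩))
  have h2 := abs_le.1 (hbound (w - ε) (abs_le.2 ⟨by linarith [hw.1], by linarith [hw.2]⟩))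
  have h3 := h.monotone_clip (show g t + w * deriv g t ≤ g (t + (w + ε)) by linarith [h1.1])
  have h4 := h.monotone_clip (show g (t + (w - ε)) ≤ g t + w * deriv g t by linarith [h2.2])
  have h5 : f 0 ≤ t + (w + ε) := by linarith [hw.1]
  have h6 : f 0 ≤ t + (w - ε) := by linarith [hw.1]
  rw [clip_of_nonneg (h.inv_nonneg h5), h.right_inv h5] at h3
  rw [clip_of_nonneg (h.inv_nonneg h6), h.right_inv h6] at h4
  rw [abs_le]
  constructor <;> linarith

theorem integrableOn_of_Ici (h : IsProfile f g) {x : ℝ}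
    (hx : IntegrableOn (fun s => exp (-(b * f s))) (Ici x)) :
    IntegrableOn (fun s => exp (-(b * f s))) (Ici 0) := by
  have hc : ContinuousOn (fun s => exp (-(b * f s))) (Ici 0) :=
    (continuousOn_const.mul h.continuousOn).neg.rexp
  refine ((hc.mono Icc_subset_Ici_self).integrableOn_Icc (b := x) |>.union hx).mono_set
    fun s hs => ?_
  rcases le_total s x with h1 | h1
  · exact Or.inl ⟨hs, h1⟩
  · exact Or.inr h1

section Tail

variable (h : IsProfile f g) (hint : IntegrableOn (fun s => exp (-(b * f s))) (Ici 0))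

include hint in
theorem tail_eq {x : ℝ} (hx : 0 ≤ x) :
    tail b f x = tail b f 0 - ∫ s in (0:ℝ)..x, exp (-(b * f s)) := by
  have := intervalIntegral.integral_Ioi_sub_Ioi (hint.mono_set Ioi_subset_Ici_self) hx
  rw [tail, tail, integral_Ici_eq_integral_Ioi, integral_Ici_eq_integral_Ioi, ← this]
  ring

include hint in
theorem tendsto_tail : Tendsto (tail b f) atTop (nhds 0) := by
  have h1 := intervalIntegral_tendsto_integral_Ioi 0 (hint.mono_set Ioi_subset_Ici_self)
    tendsto_id
  rw [← integral_Ici_eq_integral_Ioi] at h1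
  have h2 := h1.const_sub (tail b f 0)
  rw [tail, sub_self] at h2
  refine h2.congr' ?_
  filter_upwards [eventually_ge_atTop 0] with x hx
  rw [tail_eq hint hx]
  rfl

include h hint in
theorem hasDerivAt_tail {x : ℝ} (hx : 0 < x) :
    HasDerivAt (tail b f) (-exp (-(b * f x))) x := by
  have hc : ContinuousOn (fun s => exp (-(b * f s))) (Ici 0) :=
    (continuousOn_const.mul h.continuousOn).neg.rexp
  have h1 : HasDerivAt (fun x => ∫ s in (0:ℝ)..x, exp (-(b * f s))) (exp (-(b * f x))) x :=
    intervalIntegral.integral_hasDerivAt_right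
      ((hc.mono (by rw [uIcc_of_le hx.le]; exact Icc_subset_Ici_self)).intervalIntegrable)
      ((hc.mono Ioi_subset_Ici_self).stronglyMeasurableAtFilter isOpen_Ioi x hx)
      (hc.continuousAt (Ici_mem_nhds hx))
  refine (h1.const_sub (tail b f 0)).congr_of_eventuallyEq ?_
  filter_upwards [Ioi_mem_nhds hx] with y hy using tail_eq hint (le_of_lt hy)

include h hint in
theorem hasDerivAt_tail_inv {t : ℝ} (ht : f 0 < t) :
    HasDerivAt (fun t => tail b f (g t)) (-(exp (-(b * t)) * deriv g t)) t := by
  have h1 := (h.hasDerivAt_tail hint (h.inv_pos ht)).comp t (h.hasDerivAt_inv' ht)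
  rw [h.right_inv ht.le] at h1
  exact h1.congr_deriv (by ring)

include h in
theorem tendsto_inv : Tendsto g atTop atTop := by
  refine tendsto_atTop.2 fun x => ?_
  filter_upwards [eventually_ge_atTop (f (max x 0))] with t ht
  have h0 : f 0 ≤ f (max x 0) :=
    h.strictMonoOn.monotoneOn self_mem_Ici (mem_Ici.2 (le_max_right _ _)) (le_max_right _ _)
  calc x ≤ max x 0 := le_max_left _ _
    _ = g (f (max x 0)) := (h.left_inv _ (mem_Ici.2 (le_max_right _ _))).symm
    _ ≤ g t := h.inv_strictMonoOn.monotoneOn h0 (h0.trans ht) ht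

include hint in
theorem tail_antitoneOn : AntitoneOn (tail b f) (Ici 0) := by
  intro x hx y _ hxy
  refine setIntegral_mono_set (hint.mono_set (Ici_subset_Ici.2 hx))
    (Eventually.of_forall fun _ => (exp_pos _).le) ?_
  exact (Ici_subset_Ici.2 hxy).eventuallyLE

end Tail

end IsProfile

/-- Continuous solutions of the radial integral equation with nonlinearity `exp ∘ φ` and central
value `ρ`. -/
structure IsRegular (α γ b : ℝ) (φ : ℝ → ℝ) (ρ : ℝ) (y : ℝ → ℝ) : Prop where
  cont : Continuous y
  eq_sub_drop : ∀ r, 0 ≤ r → y r = ρ - drop α γ b (fun s => φ (y s)) r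

namespace IsRegular

variable {α γ b e ρ : ℝ} {φ y : ℝ → ℝ}

theorem apply_zero (h : IsRegular α γ b φ ρ y) : y 0 = ρ := by
  rw [h.eq_sub_drop 0 le_rfl, drop_zero, sub_zero]

section

variable (h : IsRegular α γ b φ ρ y) (hφ : Continuous φ)

include h hφ

theorem cont_comp : Continuous fun s => φ (y s) := hφ.comp h.cont

variable (hγ : -1 < γ) (hb : 0 < b) (he : e = (γ + 1 - α) * b + 1) (he0 : 0 < e)

include hγ hb he he0

theorem strictAntiOn : StrictAntiOn y (Ici 0) := by
  intro r hr s hs hrs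
  rw [h.eq_sub_drop r hr, h.eq_sub_drop s hs]
  exact sub_lt_sub_left (drop_strictMonoOn hγ hb he he0 (h.cont_comp hφ) hr hs hrs) ρ

theorem le_center {r : ℝ} (hr : 0 ≤ r) : y r ≤ ρ := by
  have := (h.strictAntiOn hφ hγ hb he he0).antitoneOn self_mem_Ici hr hr
  rwa [h.apply_zero] at this

theorem hasDerivAt {r : ℝ} (hr : 0 < r) :
    HasDerivAt y (-(r ^ (-(α * b)) * flux γ (fun s => φ (y s)) r ^ b)) r := by
  refine ((hasDerivAt_drop hγ hb he he0 (h.cont_comp hφ) hr).const_sub ρ).congr_of_eventuallyEq ?_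
  filter_upwards [Ioi_mem_nhds hr] with s hs using h.eq_sub_drop s (le_of_lt hs)

end

section Family

variable {Y : ℝ → ℝ → ℝ} {ρ₀ ρ₁ L : ℝ}
  (hY : ∀ ρ ∈ Icc ρ₀ ρ₁, IsRegular α γ b φ ρ (Y ρ)) (hφ : Continuous φ) (hφm : Monotone φ)
  (hL : 0 < L) (hφL : ∀ x y, x ≤ ρ₁ → y ≤ ρ₁ → |φ x - φ y| ≤ L * |x - y|)
  (hγ : -1 < γ) (hb : 0 < b) (he : e = (γ + 1 - α) * b + 1) (he0 : 0 < e)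

include hY hφ hφm hL hφL hγ hb he he0

theorem exists_lipschitz (S : ℝ) : ∃ C, 0 ≤ C ∧ ∀ ρ ∈ Icc ρ₀ ρ₁, ∀ ρ' ∈ Icc ρ₀ ρ₁,
    ∀ r ∈ Icc 0 S, |Y ρ r - Y ρ' r| ≤ C * |ρ - ρ'| := by
  have hle : ∀ ρ ∈ Icc ρ₀ ρ₁, ∀ r, 0 ≤ r → Y ρ r ≤ ρ₁ := fun ρ hρ r hr =>
    ((hY ρ hρ).le_center hφ hγ hb he he0 hr).trans hρ.2
  refine ⟨2 * exp (2 * L * (b * (exp (φ ρ₁) / (γ + 1)) ^ b / e * S ^ e)), by positivity,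
    fun ρ hρ ρ' hρ' r hr => ?_⟩
  refine (abs_sub_le_gronwall (H := φ ρ₁) (η := 0) hγ hb he he0 hL le_rfl
    ((hY ρ hρ).cont_comp hφ) ((hY ρ' hρ').cont_comp hφ) (hY ρ hρ).eq_sub_drop
    (hY ρ' hρ').eq_sub_drop (fun s hs => hφm (hle ρ hρ s hs.1))
    (fun s hs => hφm (hle ρ' hρ' s hs.1))
    (fun s hs => by
      rw [add_zero]
      exact hφL _ _ (hle ρ hρ s hs.1) (hle ρ' hρ' s hs.1)) r hr).trans (le_of_eq ?_)
  ring

theorem continuousOn_family (S : ℝ) :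
    ContinuousOn (Function.uncurry Y) (Icc ρ₀ ρ₁ ×ˢ Icc 0 S) := by
  obtain ⟨C, hC, h⟩ := exists_lipschitz hY hφ hφm hL hφL hγ hb he he0 S
  refine continuousOn_prod_of_continuousOn_lipschitzOnWith _ ⟨C, hC⟩
    (fun ρ hρ => (hY ρ hρ).cont.continuousOn) fun r hr => ?_
  exact LipschitzOnWith.of_dist_le_mul fun ρ hρ ρ' hρ' => h ρ hρ ρ' hρ' r hr

theorem continuousOn_flux_family (S : ℝ) :
    ContinuousOn (Function.uncurry fun ρ => flux γ fun s => φ (Y ρ s))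
      (Icc ρ₀ ρ₁ ×ˢ Icc 0 S) := by
  obtain ⟨C, hC, h⟩ := exists_lipschitz hY hφ hφm hL hφL hγ hb he he0 S
  have hγ' : 0 < γ + 1 := by linarith
  have hle : ∀ ρ ∈ Icc ρ₀ ρ₁, ∀ r, 0 ≤ r → Y ρ r ≤ ρ₁ := fun ρ hρ r hr =>
    ((hY ρ hρ).le_center hφ hγ hb he he0 hr).trans hρ.2
  set A := L * C * (exp (φ ρ₁) * (|S| ^ (γ + 1) / (γ + 1))) with hA
  have hA0 : 0 ≤ A := by positivity
  refine continuousOn_prod_of_continuousOn_lipschitzOnWith _ ⟨A, hA0⟩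
    (fun ρ hρ => (continuous_flux hγ ((hY ρ hρ).cont_comp hφ)).continuousOn) fun r hr => ?_
  refine LipschitzOnWith.of_dist_le_mul fun ρ hρ ρ' hρ' => ?_
  have h1 := abs_flux_sub_le (ε := L * (C * |ρ - ρ'|)) (H := φ ρ₁) hγ
    ((hY ρ hρ).cont_comp hφ) ((hY ρ' hρ').cont_comp hφ) hr.1
    (fun s hs => (hφL _ _ (hle ρ hρ s hs.1) (hle ρ' hρ' s hs.1)).trans
      (mul_le_mul_of_nonneg_left (h ρ hρ ρ' hρ' s ⟨hs.1, hs.2.trans hr.2⟩) hL.le))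
    (by positivity) (fun s hs => hφm (hle ρ hρ s hs.1)) (fun s hs => hφm (hle ρ' hρ' s hs.1))
  have h2 : r ^ (γ + 1) ≤ |S| ^ (γ + 1) :=
    rpow_le_rpow hr.1 (hr.2.trans (le_abs_self S)) hγ'.le
  rw [Real.dist_eq, Real.dist_eq]
  refine h1.trans ?_
  calc L * (C * |ρ - ρ'|) * (exp (φ ρ₁) * (r ^ (γ + 1) / (γ + 1)))
      ≤ L * (C * |ρ - ρ'|) * (exp (φ ρ₁) * (|S| ^ (γ + 1) / (γ + 1))) := by gcongr
    _ = A * |ρ - ρ'| := by rw [hA]; ring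

end Family

/-- A regular solution vanishing only at `R` agrees there with a solution of the equation whose
nonlinearity is frozen at negative values. -/
theorem exists_of_integral_eq {f g u : ℝ → ℝ} {R : ℝ} (hf : IsProfile f g)
    (hγ : -1 < γ) (hb : 0 < b) (he : e = (γ + 1 - α) * b + 1) (he0 : 0 < e) (hρ : 0 < ρ)
    (hu : ContinuousOn u (Ici 0))
    (hueq : ∀ r, 0 ≤ r → u r = ρ - drop α γ b (fun s => f (u s)) r)
    (hR : 0 < R) (huR : u R = 0) (hR' : ∀ r, 0 < r → u r = 0 → r = R) :
    ∃ y, IsRegular α γ b (clip f) ρ y ∧ y R = 0 := by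
  have hu0 : u 0 = ρ := by rw [hueq 0 le_rfl, drop_zero, sub_zero]
  have hpos : ∀ r ∈ Icc 0 R, 0 ≤ u r := by
    intro r hr
    by_contra! hneg
    obtain ⟨s, hs, hs0⟩ := intermediate_value_Ioo' hr.1 (hu.mono Icc_subset_Ici_self)
      (show (0:ℝ) ∈ Ioo (u r) (u 0) from ⟨hneg, hu0 ▸ hρ⟩)
    have := hR' s hs.1 hs0
    linarith [hs.2, hr.2]
  set h : ℝ → ℝ := fun s => clip f (u (min (max s 0) R)) with hh
  have hhc : Continuous h := hf.continuous_clip.comp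
    (hu.comp_continuous (by fun_prop) fun s => le_min (le_max_right _ _) hR.le)
  have hin : ∀ s ∈ Icc 0 R, f (u s) = h s := fun s hs => by
    simp only [hh, max_eq_left hs.1, min_eq_left hs.2, clip_of_nonneg (hpos s hs)]
  set y : ℝ → ℝ := fun r => ρ - drop α γ b h (max r 0) with hy
  have hyc : Continuous y := continuous_const.sub
    ((continuousOn_drop hγ hb he he0 hhc).comp_continuous (by fun_prop)
      fun s => mem_Ici.2 (le_max_right _ _))
  have hyu : ∀ r ∈ Icc 0 R, y r = u r := fun r hr => by
    rw [hueq r hr.1]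
    simp only [hy, max_eq_left hr.1]
    rw [drop_congr hr.1 fun s hs => hin s ⟨hs.1, hs.2.trans hr.2⟩]
  have hyR : y R = 0 := by rw [hyu R ⟨hR.le, le_rfl⟩, huR]
  have hyh : ∀ s, 0 ≤ s → clip f (y s) = h s := by
    intro s hs
    rcases le_total s R with h1 | h1
    · rw [hyu s ⟨hs, h1⟩, clip_of_nonneg (hpos s ⟨hs, h1⟩), hin s ⟨hs, h1⟩]
    · have h2 : y s ≤ 0 := by
        rw [← hyR]
        simp only [hy, max_eq_left hs, max_eq_left hR.le]
        exact sub_le_sub_left ((drop_strictMonoOn hγ hb he he0 hhc).monotoneOn hR.le hs h1) ρ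
      simp only [hh, max_eq_left hs, min_eq_right h1, huR]
      rw [clip, clip, max_eq_right h2, max_self]
  refine ⟨y, ⟨hyc, fun r hr => ?_⟩, hyR⟩
  rw [drop_congr hr fun s hs => hyh s hs.1]
  simp only [hy, max_eq_left hr]

end IsRegular

section Scaling

variable {α γ b e κ c r : ℝ} {h : ℝ → ℝ}

theorem flux_mul (hκ : 0 < κ) (hr : 0 ≤ r) :
    flux γ h (κ * r) = κ ^ (γ + 1) * exp c * flux γ (fun s => h (κ * s) - c) r := by
  unfold flux
  have h1 := intervalIntegral.mul_integral_comp_mul_left (a := 0) (b := r)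
    (f := fun s => s ^ γ * exp (h s)) κ
  rw [mul_zero] at h1
  rw [← h1, ← intervalIntegral.integral_const_mul, ← intervalIntegral.integral_const_mul]
  refine intervalIntegral.integral_congr fun s hs => ?_
  rw [uIcc_of_le hr] at hs
  simp only
  rw [mul_rpow hκ.le hs.1, rpow_add_one hκ.ne', exp_sub]
  field_simp

theorem drop_mul (hγ : -1 < γ) (he : e = (γ + 1 - α) * b + 1) (hh : Continuous h)
    (hκ : 0 < κ) (hr : 0 ≤ r) :
    drop α γ b h (κ * r) = κ ^ e * exp (b * c) * drop α γ b (fun s => h (κ * s) - c) r := by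
  have h1 := intervalIntegral.mul_integral_comp_mul_left (a := 0) (b := r)
    (f := slope α γ b h) κ
  rw [mul_zero] at h1
  unfold drop
  rw [← h1, ← intervalIntegral.integral_const_mul, ← intervalIntegral.integral_const_mul]
  refine intervalIntegral.integral_congr fun s hs => ?_
  rw [uIcc_of_le hr] at hs
  simp only [slope]
  have hfl : 0 ≤ flux γ (fun s => h (κ * s) - c) s := by
    rcases hs.1.eq_or_lt with h0 | h0
    · rw [← h0, flux_zero]
    · exact (flux_pos hγ (by fun_prop) h0).le
  rw [flux_mul (c := c) hκ hs.1, mul_rpow hκ.le hs.1, mul_rpow (by positivity) hfl,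
    mul_rpow (by positivity) (exp_pos _).le, ← rpow_mul hκ.le, ← exp_mul, mul_comm c b,
    show e = 1 + -(α * b) + (γ + 1) * b by rw [he]; ring, rpow_add hκ, rpow_add hκ, rpow_one]
  ring

end Scaling

namespace IsRegular

variable {α γ b e : ℝ}

theorem rescale {ρ κ c m : ℝ} {φ y : ℝ → ℝ} (h : IsRegular α γ b φ ρ y) (hφ : Continuous φ)
    (hγ : -1 < γ) (he : e = (γ + 1 - α) * b + 1) (hκ : 0 < κ) (hm : 0 < m)
    (hκm : κ ^ e * exp (b * c) = m) :
    IsRegular α γ b (fun x => φ (ρ + x * m) - c) 0 (fun s => (y (κ * s) - ρ) / m) := by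
  have hy := h.cont
  refine ⟨by fun_prop, fun r hr => ?_⟩
  have h1 := h.eq_sub_drop (κ * r) (by positivity)
  rw [drop_mul (c := c) hγ he (h.cont_comp hφ) hκ hr, hκm] at h1
  have h2 : (fun s => φ (ρ + (y (κ * s) - ρ) / m * m) - c) = fun s => φ (y (κ * s)) - c := by
    ext s
    rw [div_mul_cancel₀ _ hm.ne', add_sub_cancel]
  rw [h2, h1]
  field_simp
  ring

/-- Regular solutions for nonlinearities converging locally uniformly to the identity converge. -/
theorem exists_limit {ψ w : ℝ → ℝ → ℝ} (hγ : -1 < γ) (hb : 0 < b)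
    (he : e = (γ + 1 - α) * b + 1) (he0 : 0 < e)
    (hw : ∀ᶠ t in atTop, IsRegular α γ b (ψ t) 0 (w t))
    (hψc : ∀ᶠ t in atTop, Continuous (ψ t)) (hψ0 : ∀ᶠ t in atTop, ∀ x ≤ 0, ψ t x ≤ 0)
    (hψ : ∀ W ε : ℝ, 0 ≤ W → 0 < ε → ∀ᶠ t in atTop, ∀ x ∈ Icc (-W) 0, |ψ t x - x| ≤ ε) :
    ∃ w₀, IsRegular α γ b id 0 w₀ ∧
      (∀ r, 0 ≤ r → Tendsto (fun t => ψ t (w t r)) atTop (nhds (w₀ r))) := by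
  set A : ℝ → ℝ := fun S => b * (exp 0 / (γ + 1)) ^ b / e * S ^ e with hA
  have hγ' : 0 < γ + 1 := by linarith
  have hA0 : ∀ S, 0 ≤ S → 0 ≤ A S := fun S hS => by simp only [hA]; positivity
  have hwneg : ∀ᶠ t in atTop, ∀ r, 0 ≤ r → w t r ≤ 0 := by
    filter_upwards [hw, hψc] with t h1 h2 r hr using h1.le_center h2 hγ hb he he0 hr
  have hnear : ∀ S ε : ℝ, 0 < ε → ∀ᶠ t in atTop, ∀ r ∈ Icc 0 S,
      |ψ t (w t r) - w t r| ≤ ε := by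
    intro S ε hε
    filter_upwards [hw, hψc, hψ0, hwneg, hψ ((exp 0 / (γ + 1)) ^ b / e * |S| ^ e) ε
      (by positivity) hε] with t h1 h2 h3 h4 h5 r hr
    refine h5 _ ⟨?_, h4 r hr.1⟩
    have h6 := drop_le (H := 0) hγ hb he he0 (h1.cont_comp h2) hr.1 fun s hs => h3 _ (h4 s hs.1)
    have h7 := h1.eq_sub_drop r hr.1
    have h8 : r ^ e ≤ |S| ^ e := rpow_le_rpow hr.1 (hr.2.trans (le_abs_self S)) he0.le
    have h9 : (exp 0 / (γ + 1)) ^ b / e * r ^ e ≤ (exp 0 / (γ + 1)) ^ b / e * |S| ^ e := by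
      gcongr
    linarith
  set W : ℝ → ℝ → ℝ := fun t r => w t (max r 0) with hW
  have hcauchy : ∀ S, 0 ≤ S → UniformCauchySeqOn W atTop (Iic S) := by
    intro S hS
    rw [Metric.uniformCauchySeqOn_iff]
    intro ε hε
    set B := 4 * A S * exp (2 * A S) with hB
    have hB0 : 0 ≤ B := by have := hA0 S hS; positivity
    have hη : 0 < ε / (B + 1) := by positivity
    obtain ⟨T, hT⟩ := eventually_atTop.1
      (hw.and (hψc.and (hψ0.and (hwneg.and (hnear S (ε / (B + 1)) hη)))))
    refine ⟨T, fun t ht t' ht' r hr => ?_⟩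
    obtain ⟨a1, a2, a3, a4, a5⟩ := hT t ht
    obtain ⟨b1, b2, b3, b4, b5⟩ := hT t' ht'
    have hmem : max r 0 ∈ Icc 0 S := ⟨le_max_right _ _, max_le hr hS⟩
    have h1 := abs_sub_le_gronwall (S := S) (H := 0) (L := 1) (η := 2 * (ε / (B + 1))) hγ hb he he0
      one_pos (by positivity) (a1.cont_comp a2) (b1.cont_comp b2) a1.eq_sub_drop b1.eq_sub_drop
      (fun s hs => a3 _ (a4 s hs.1)) (fun s hs => b3 _ (b4 s hs.1))
      (fun s hs => by
        have e1 := abs_le.1 (a5 s hs)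
        have e2 := abs_le.1 (b5 s hs)
        have e3 := abs_le.1 (le_refl |w t s - w t' s|)
        rw [abs_le]
        constructor <;> linarith [e1.1, e1.2, e2.1, e2.2, e3.1, e3.2]) _ hmem
    rw [Real.dist_eq]
    refine h1.trans_lt ?_
    rw [sub_self, abs_zero, zero_add, mul_one]
    change 2 * (2 * (ε / (B + 1)) * A S) * exp (2 * A S) < ε
    calc 2 * (2 * (ε / (B + 1)) * A S) * exp (2 * A S) = ε * (B / (B + 1)) := by
          rw [hB]; ring
      _ < ε * 1 := by
          gcongr
          rw [div_lt_one (by positivity)]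
          linarith
      _ = ε := mul_one ε
  have hex : ∀ r, ∃ l, Tendsto (fun t => W t r) atTop (nhds l) := fun r =>
    cauchySeq_tendsto_of_complete
      ((hcauchy |r| (abs_nonneg r)).cauchySeq (le_abs_self r))
  choose w₀ hw₀ using hex
  have hunif : ∀ S, 0 ≤ S → TendstoUniformlyOn W w₀ atTop (Iic S) := fun S hS =>
    (hcauchy S hS).tendstoUniformlyOn_of_tendsto fun r _ => hw₀ r
  have hcont : Continuous w₀ := by
    rw [continuous_iff_continuousAt]
    intro r
    have h1 := (hunif (|r| + 1) (by positivity)).continuousOn (by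
      refine Eventually.frequently ?_
      filter_upwards [hw] with t ht
      exact (ht.cont.comp (by fun_prop)).continuousOn)
    exact h1.continuousAt (Iic_mem_nhds (by linarith [le_abs_self r]))
  have hw₀' : ∀ r, 0 ≤ r → Tendsto (fun t => w t r) atTop (nhds (w₀ r)) := fun r hr => by
    have := hw₀ r
    simpa only [hW, max_eq_left hr] using this
  have hw₀neg : ∀ r, 0 ≤ r → w₀ r ≤ 0 := fun r hr =>
    le_of_tendsto (hw₀' r hr) (hwneg.mono fun t ht => ht r hr)
  have hψw : ∀ S ε : ℝ, 0 ≤ S → 0 < ε → ∀ᶠ t in atTop, ∀ r ∈ Icc 0 S,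
      |ψ t (w t r) - w₀ r| ≤ ε := by
    intro S ε hS hε
    filter_upwards [hnear S (ε / 2) (half_pos hε),
      Metric.tendstoUniformlyOn_iff.1 (hunif S hS) (ε / 2) (half_pos hε)] with t h1 h2 r hr
    have h3 := h2 r hr.2
    simp only [hW, max_eq_left hr.1, Real.dist_eq] at h3
    have h4 := abs_le.1 (h1 r hr)
    have h5 := abs_lt.1 h3
    rw [abs_le]
    constructor <;> linarith [h4.1, h4.2, h5.1, h5.2]
  refine ⟨w₀, ⟨hcont, fun r hr => ?_⟩, fun r hr => ?_⟩
  · have hdrop : Tendsto (fun t => drop α γ b (fun s => ψ t (w t s)) r) atTop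
        (nhds (drop α γ b (fun s => id (w₀ s)) r)) := by
      rw [Metric.tendsto_nhds]
      intro ε hε
      have hη : 0 < ε / (A r + 1) := div_pos hε (by linarith [hA0 r hr])
      filter_upwards [hw, hψc, hψ0, hwneg, hψw r (ε / (A r + 1)) hr hη] with t h1 h2 h3 h4 h5
      have h6 := abs_drop_sub_le (α := α) (h₁ := fun s => ψ t (w t s)) (h₂ := fun s => id (w₀ s))
        (H := 0) hγ hb he he0 (h1.cont_comp h2) hcont hr h5 hη.le (fun s hs => h3 _ (h4 s hs.1))
        (fun s hs => hw₀neg s hs.1)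
      rw [Real.dist_eq]
      refine h6.trans_lt ?_
      calc b * (ε / (A r + 1)) * (exp 0 / (γ + 1)) ^ b / e * r ^ e
          = ε * (A r / (A r + 1)) := by simp only [hA]; ring
        _ < ε * 1 := by
            gcongr
            rw [div_lt_one (by linarith [hA0 r hr])]
            linarith
        _ = ε := mul_one ε
    refine tendsto_nhds_unique (hw₀' r hr) ((hdrop.const_sub 0).congr' ?_)
    filter_upwards [hw] with t ht using (ht.eq_sub_drop r hr).symm
  · rw [Metric.tendsto_nhds]
    intro ε hε
    filter_upwards [hψw r (ε / 2) hr (half_pos hε)] with t ht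
    rw [Real.dist_eq]
    linarith [ht r ⟨hr, le_rfl⟩]

end IsRegular

section Oscillation

theorem exists_lipschitz_rpow {m : ℝ} (hm : 0 < m) (M b : ℝ) : ∃ C, 0 ≤ C ∧
    ∀ x ∈ Icc m M, ∀ y ∈ Icc m M, |x ^ b - y ^ b| ≤ C * |x - y| := by
  have hc : ContDiffOn ℝ 1 (fun x : ℝ => x ^ b) (Icc m M) := fun x hx =>
    (contDiffAt_rpow_const_of_ne (hm.trans_le hx.1).ne').contDiffWithinAt
  obtain ⟨K, hK⟩ := hc.exists_lipschitzOnWith one_ne_zero (convex_Icc m M) isCompact_Icc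
  exact ⟨K, K.2, fun x hx y hy => hK.dist_le_mul x hx y hy⟩

theorem exists_lipschitz_exp (M : ℝ) : ∃ C, 0 ≤ C ∧
    ∀ x, |x| ≤ M → ∀ y, |y| ≤ M → |exp x - exp y| ≤ C * |x - y| := by
  obtain ⟨K, hK⟩ := (contDiff_exp.contDiffOn (n := 1)).exists_lipschitzOnWith one_ne_zero
    (convex_Icc (-M) M) isCompact_Icc
  exact ⟨K, K.2, fun x hx y hy => hK.dist_le_mul x (abs_le.1 hx) y (abs_le.1 hy)⟩

theorem exists_mem_Icc_of_pos {P : ℝ → ℝ} {c d : ℝ} (hP : ContinuousOn P (Icc c d))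
    (hpos : ∀ r ∈ Icc c d, 0 < P r) : ∃ m M, 0 < m ∧ ∀ r ∈ Icc c d, P r ∈ Icc m M := by
  rcases (Icc c d).eq_empty_or_nonempty with h0 | h0
  · exact ⟨1, 1, one_pos, by simp [h0]⟩
  obtain ⟨x, hx, hxm⟩ := isCompact_Icc.exists_isMinOn h0 hP
  obtain ⟨y, hy, hyM⟩ := isCompact_Icc.exists_isMaxOn h0 hP
  exact ⟨P x, P y, hpos x hx, fun r hr => ⟨hxm hr, hyM hr⟩⟩

section Autonomous

variable {x q : ℝ → ℝ} {a b θ : ℝ}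
  (ha : 0 < a) (hb : 0 < b) (hθ : 0 < θ)
  (hx : ∀ t, HasDerivAt x (a * (exp (q t) - 1 - x t)) t)
  (hq : ∀ t, HasDerivAt q (θ * (1 - (1 + x t) ^ b)) t)
  (hpos : ∀ t, 0 < 1 + x t)

include hx hq hpos in
theorem ne_zero_of_deriv_eq_zero (hneg : ∃ t₀, ∀ t ≤ t₀, q t < 0) {t : ℝ} (hqt : q t = 0) :
    x t ≠ 0 := by
  intro hxt
  obtain ⟨t₀, ht₀⟩ := hneg
  set s := min t t₀ with hs
  have hst : s ≤ t := min_le_left _ _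
  have hxc : Continuous x := continuous_iff_continuousAt.2 fun t => (hx t).continuousAt
  have hqc : Continuous q := continuous_iff_continuousAt.2 fun t => (hq t).continuousAt
  obtain ⟨m, M, hm, hmM⟩ := exists_mem_Icc_of_pos (P := fun t => 1 + x t) (c := s) (d := t)
    (by fun_prop) fun r _ => hpos r
  obtain ⟨Q, hQ⟩ := (isCompact_Icc (a := s) (b := t)).exists_bound_of_continuousOn
    hqc.continuousOn
  obtain ⟨C₁, hC₁, h₁⟩ := exists_lipschitz_rpow hm M b
  obtain ⟨C₂, hC₂, h₂⟩ := exists_lipschitz_exp Q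
  have hone : (1:ℝ) ∈ Icc m M := by
    have := hmM t ⟨hst, le_rfl⟩
    simpa [hxt] using this
  have hQ0 : |(0:ℝ)| ≤ Q := by simpa [hqt] using hQ t ⟨hst, le_rfl⟩
  have hzero : q s = 0 := by
    refine eq_zero_of_hasDerivAt_le (C := |θ| * C₁ + |a| * (C₂ + 1)) hst (fun r _ => hq r)
      (fun r _ => hx r) (fun r hr => ?_) (fun r hr => ?_) hqt hxt
    · have h3 := h₁ 1 hone _ (hmM r hr)
      rw [one_rpow, show 1 - (1 + x r) = - x r by ring, abs_neg] at h3
      have h4 : |θ| * |1 - (1 + x r) ^ b| ≤ |θ| * (C₁ * |x r|) := by gcongr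
      rw [abs_mul]
      have h5 : 0 ≤ |θ| * C₁ * |q r| := by positivity
      have h6 : 0 ≤ |a| * (C₂ + 1) * (|q r| + |x r|) := by positivity
      linarith
    · have h3 := h₂ (q r) (hQ r hr) 0 hQ0
      rw [exp_zero, sub_zero] at h3
      have h4 : |exp (q r) - 1 - x r| ≤ C₂ * |q r| + |x r| := (abs_sub _ _).trans (by linarith)
      have h4' : |a| * |exp (q r) - 1 - x r| ≤ |a| * (C₂ * |q r| + |x r|) := by gcongr
      rw [abs_mul]
      have h5 : 0 ≤ |a| * |q r| := by positivity
      have h6 : 0 ≤ |a| * C₂ * |x r| := by positivity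
      have h7 : 0 ≤ |θ| * C₁ * (|q r| + |x r|) := by positivity
      linarith
  exact (ht₀ s (min_le_right _ _)).ne hzero

include hb hθ hq hpos in
theorem eq_zero_of_isLocalExtr {t : ℝ} (h : IsLocalExtr q t) : x t = 0 := by
  have h1 := h.hasDerivAt_eq_zero (hq t)
  have h2 : (1 + x t) ^ b = 1 := by
    rcases mul_eq_zero.1 h1 with h3 | h3
    · exact absurd h3 hθ.ne'
    · linarith
  have := (rpow_left_inj (hpos t).le zero_le_one hb.ne').1 (h2.trans (one_rpow b).symm)
  linarith

theorem hasDerivAt_focus_rpow (σ : ℝ) :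
    HasDerivAt (fun y => θ * ((max (1 + σ * y) 0) ^ b - 1)) (σ * (θ * b)) 0 := by
  have h1 : HasDerivAt (fun y : ℝ => 1 + σ * y) σ 0 := by
    simpa using ((hasDerivAt_id (0:ℝ)).const_mul σ).const_add 1
  have h2 := ((h1.rpow_const (p := b) (Or.inl (by simp))).sub_const 1).const_mul θ
  refine (h2.congr_of_eventuallyEq ?_).congr_deriv (by simp; ring)
  have h3 : ∀ᶠ y in nhds (0:ℝ), 0 < 1 + σ * y :=
    h1.continuousAt.eventually (lt_mem_nhds (by simp))
  filter_upwards [h3] with y hy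
  rw [max_eq_left hy.le]

include ha hb hθ hx hq hpos in
/-- In the oscillatory regime every non-constant orbit emanating from `-∞` winds around the
equilibrium forever. -/
theorem exists_neg_and_exists_pos (hcond : a < 4 * (θ * b)) (hneg : ∃ t₀, ∀ t ≤ t₀, q t < 0)
    (T : ℝ) : (∃ t, T < t ∧ q t < 0) ∧ ∃ t, T < t ∧ 0 < q t := by
  constructor
  · by_contra! hcon
    refine not_forall_pos_of_focus (x := x) (q := q) (φ := fun y => exp y - 1)
      (ψ := fun y => θ * ((max (1 + 1 * y) 0) ^ b - 1)) (a := a) (k := θ * b) (T := T + 1)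
      ha hcond ?_ ?_ (by simp) (by simp) ?_ ?_ ?_ ?_ ?_ ?_ ?_
    · exact fun y z h => sub_le_sub_right (exp_le_exp.2 h) 1
    · intro y z h
      simp only
      gcongr
    · intro y hy
      simpa using hy
    · intro y hy
      refine mul_pos hθ (sub_pos.2 ?_)
      exact one_lt_rpow (lt_max_of_lt_left (by linarith)) hb
    · simpa using (hasDerivAt_exp 0).sub_const 1
    · simpa using hasDerivAt_focus_rpow (θ := θ) (b := b) 1
    · exact fun t _ => hx t
    · intro t _
      refine (hq t).congr_deriv ?_
      rw [one_mul, max_eq_left (hpos t).le]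
      ring
    · intro t ht
      have ht' : T < t := by linarith
      refine (hcon t ht').lt_of_ne' fun h0 => ?_
      refine ne_zero_of_deriv_eq_zero hx hq hpos hneg h0
        (eq_zero_of_isLocalExtr hb hθ hq hpos (Or.inl ?_))
      filter_upwards [Ioi_mem_nhds ht'] with s hs
      rw [h0]
      exact hcon s hs
  · by_contra! hcon
    refine not_forall_pos_of_focus (x := fun t => -x t) (q := fun t => -q t)
      (φ := fun y => -(exp (-y) - 1))
      (ψ := fun y => -(θ * ((max (1 + (-1) * y) 0) ^ b - 1))) (a := a) (k := θ * b) (T := T + 1)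
      ha hcond ?_ ?_ (by simp) (by simp) ?_ ?_ ?_ ?_ ?_ ?_ ?_
    · exact fun y z h => neg_le_neg (sub_le_sub_right (exp_le_exp.2 (neg_le_neg h)) 1)
    · intro y z h
      refine neg_le_neg (mul_le_mul_of_nonneg_left (sub_le_sub_right ?_ 1) hθ.le)
      exact rpow_le_rpow (le_max_right _ _) (max_le_max_right 0 (by linarith)) hb.le
    · intro y hy
      simpa using hy
    · intro y hy
      rw [Left.neg_pos_iff]
      refine mul_neg_of_pos_of_neg hθ (sub_neg.2 ?_)
      exact rpow_lt_one (le_max_right _ _) (max_lt (by linarith) one_pos) hb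
    · exact (((hasDerivAt_exp (-0)).comp (0:ℝ) (hasDerivAt_neg 0)).sub_const 1).neg.congr_deriv
        (by simp)
    · exact (hasDerivAt_focus_rpow (θ := θ) (b := b) (-1)).neg.congr_deriv (by ring)
    · exact fun t _ => (hx t).neg.congr_deriv (by simp; ring)
    · intro t _
      refine (hq t).neg.congr_deriv ?_
      rw [show 1 + -1 * -x t = 1 + x t by ring, max_eq_left (hpos t).le]
      ring
    · intro t ht
      have ht' : T < t := by linarith
      rw [Left.neg_pos_iff]
      refine (hcon t ht').lt_of_ne fun h0 => ?_
      refine ne_zero_of_deriv_eq_zero hx hq hpos hneg h0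
        (eq_zero_of_isLocalExtr hb hθ hq hpos (Or.inr ?_))
      filter_upwards [Ioi_mem_nhds ht'] with s hs
      rw [h0]
      exact hcon s hs

end Autonomous

/-- The regular solution for the identity crosses the explicit singular one infinitely often. -/
theorem IsRegular.oscillates {α γ b a θ : ℝ} {w : ℝ → ℝ} (h : IsRegular α γ b id 0 w)
    (hγ : -1 < γ) (hb : 0 < b) (ha : 0 < a) (hab : a * b = α * b - 1) (hθ : 0 < θ)
    (hθγ : θ = γ + 1 - a) (hcond : a < 4 * (θ * b)) (S : ℝ) :
    (∃ s, 0 < s ∧ S < s ∧ w s < log (a * θ ^ (1 / b)) - θ * log s) ∧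
    (∃ s, 0 < s ∧ S < s ∧ log (a * θ ^ (1 / b)) - θ * log s < w s) := by
  have he : θ * b = (γ + 1 - α) * b + 1 := by rw [hθγ]; linarith
  have he0 : 0 < θ * b := mul_pos hθ hb
  have hc := h.cont_comp continuous_id
  set κ := θ ^ (1 / b) with hκ
  have hκ0 : 0 < κ := rpow_pos_of_pos hθ _
  have hκb : κ ^ b = θ := by rw [hκ, ← rpow_mul hθ.le, one_div_mul_cancel hb.ne', rpow_one]
  set c₀ := log (a * κ) with hc₀
  set V := flux γ fun s => id (w s) with hV
  set q : ℝ → ℝ := fun t => w (exp t) + θ * t - c₀ with hqdef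
  set x : ℝ → ℝ := fun t => exp (-(a * t)) * V (exp t) / κ - 1 with hxdef
  have hVpos : ∀ t, 0 < V (exp t) := fun t => flux_pos hγ hc (exp_pos t)
  have hrp : ∀ t p : ℝ, exp t ^ p = exp (t * p) := fun t p => (exp_mul t p).symm
  have hpos : ∀ t, 0 < 1 + x t := fun t => by
    have := hVpos t
    simp only [hxdef, add_sub_cancel]
    positivity
  have hx : ∀ t, HasDerivAt x (a * (exp (q t) - 1 - x t)) t := by
    intro t
    have h1 : HasDerivAt (fun t => exp (-(a * t))) (exp (-(a * t)) * (-(a * 1))) t :=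
      ((hasDerivAt_id t).const_mul a).neg.exp
    have h2 : HasDerivAt (fun t => V (exp t)) (exp t ^ γ * exp (w (exp t)) * exp t) t :=
      (hasDerivAt_flux hγ hc (exp_pos t)).comp t (hasDerivAt_exp t)
    refine (((h1.mul h2).div_const κ).sub_const 1).congr_deriv ?_
    have h3 : exp (q t) = exp (w (exp t)) * exp (t * γ) * exp t * exp (-(a * t)) / (a * κ) := by
      have : a * κ = exp c₀ := (exp_log (mul_pos ha hκ0)).symm
      rw [this, ← exp_add, ← exp_add, ← exp_add, ← exp_sub]
      congr 1
      simp only [hqdef]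
      rw [hθγ]
      ring
    rw [h3, hrp]
    simp only [hxdef]
    field_simp
    ring
  have hq : ∀ t, HasDerivAt q (θ * (1 - (1 + x t) ^ b)) t := by
    intro t
    have h1 := (h.hasDerivAt continuous_id hγ hb he he0 (exp_pos t)).comp t (hasDerivAt_exp t)
    have h2 := (h1.add ((hasDerivAt_id t).const_mul θ)).sub_const c₀
    refine h2.congr_deriv ?_
    have h3 : (1 + x t) ^ b = exp (-(a * t) * b) * V (exp t) ^ b / θ := by
      simp only [hxdef, add_sub_cancel]
      rw [div_rpow (mul_pos (exp_pos _) (hVpos t)).le hκ0.le, hκb,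
        mul_rpow (exp_pos _).le (hVpos t).le, hrp]
    rw [h3, hrp]
    have h4 : exp (-(a * t) * b) = exp (t * -(α * b)) * exp t := by
      rw [← exp_add]
      congr 1
      linear_combination -t * hab
    rw [h4]
    field_simp
    ring
  have hneg : ∃ t₀, ∀ t ≤ t₀, q t < 0 := by
    refine ⟨(c₀ - 1) / θ, fun t ht => ?_⟩
    have h1 := h.le_center continuous_id hγ hb he he0 (exp_pos t).le
    rw [le_div_iff₀ hθ] at ht
    simp only [hqdef]
    linarith
  obtain ⟨⟨t, ht, h1⟩, ⟨t', ht', h1'⟩⟩ :=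
    exists_neg_and_exists_pos ha hb hθ hx hq hpos hcond hneg (log (max S 1))
  have hmax : 0 < max S 1 := lt_max_of_lt_right one_pos
  have hlt : ∀ t, log (max S 1) < t → S < exp t := fun t ht =>
    (le_max_left S 1).trans_lt ((log_lt_iff_lt_exp hmax).1 ht)
  simp only [hqdef] at h1 h1'
  exact ⟨⟨exp t, exp_pos t, hlt t ht, by rw [log_exp]; linarith⟩,
    ⟨exp t', exp_pos t', hlt t' ht', by rw [log_exp]; linarith⟩⟩

end Oscillation

/-- Decreasing solutions of the radial equation with nonlinearity `exp ∘ φ` on `(0, d]`; the flux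
is `V`. -/
structure IsSolutionOn (α γ b : ℝ) (φ : ℝ → ℝ) (d : ℝ) (U V : ℝ → ℝ) : Prop where
  flux_pos : ∀ r ∈ Ioc 0 d, 0 < V r
  hasDerivAt : ∀ r ∈ Ioc 0 d, HasDerivAt U (-(r ^ (-(α * b)) * V r ^ b)) r
  hasDerivAt_flux : ∀ r ∈ Ioc 0 d, HasDerivAt V (r ^ γ * exp (φ (U r))) r

theorem IsRegular.isSolutionOn {α γ b e ρ d : ℝ} {φ y : ℝ → ℝ} (h : IsRegular α γ b φ ρ y)
    (hφ : Continuous φ) (hγ : -1 < γ) (hb : 0 < b) (he : e = (γ + 1 - α) * b + 1) (he0 : 0 < e) :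
    IsSolutionOn α γ b φ d y (flux γ fun s => φ (y s)) where
  flux_pos _ hr := flux_pos hγ (h.cont_comp hφ) hr.1
  hasDerivAt _ hr := h.hasDerivAt hφ hγ hb he he0 hr.1
  hasDerivAt_flux _ hr := hasDerivAt_flux hγ (h.cont_comp hφ) hr.1

namespace IsSolutionOn

variable {α γ b d : ℝ} {φ U₁ V₁ U₂ V₂ : ℝ → ℝ}

theorem eq_of_eq_of_flux_eq (h₁ : IsSolutionOn α γ b φ d U₁ V₁) (h₂ : IsSolutionOn α γ b φ d U₂ V₂)
    (hφ : ∀ H, ∃ L, 0 < L ∧ ∀ x y, x ≤ H → y ≤ H → |φ x - φ y| ≤ L * |x - y|)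
    {c z : ℝ} (hc : 0 < c) (hcz : c ≤ z) (hz : z ≤ d) (hU : U₁ z = U₂ z) (hV : V₁ z = V₂ z) :
    U₁ c = U₂ c := by
  have hmem : ∀ r ∈ Icc c z, r ∈ Ioc 0 d := fun r hr => ⟨hc.trans_le hr.1, hr.2.trans hz⟩
  have hUc : ∀ {U V}, IsSolutionOn α γ b φ d U V → ContinuousOn U (Icc c z) := fun h r hr =>
    (h.hasDerivAt r (hmem r hr)).continuousAt.continuousWithinAt
  have hVc : ∀ {U V}, IsSolutionOn α γ b φ d U V → ContinuousOn V (Icc c z) := fun h r hr =>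
    (h.hasDerivAt_flux r (hmem r hr)).continuousAt.continuousWithinAt
  obtain ⟨m₁, M₁, hm₁, hmM₁⟩ := exists_mem_Icc_of_pos (hVc h₁) fun r hr =>
    h₁.flux_pos r (hmem r hr)
  obtain ⟨m₂, M₂, hm₂, hmM₂⟩ := exists_mem_Icc_of_pos (hVc h₂) fun r hr =>
    h₂.flux_pos r (hmem r hr)
  obtain ⟨C₁, hC₁, hpow⟩ := exists_lipschitz_rpow (lt_min hm₁ hm₂) (max M₁ M₂) b
  obtain ⟨Q₁, hQ₁⟩ := (isCompact_Icc (a := c) (b := z)).exists_bound_of_continuousOn (hUc h₁)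
  obtain ⟨Q₂, hQ₂⟩ := (isCompact_Icc (a := c) (b := z)).exists_bound_of_continuousOn (hUc h₂)
  obtain ⟨L, hL, hφL⟩ := hφ (max Q₁ Q₂)
  have hle₁ : ∀ r ∈ Icc c z, U₁ r ≤ max Q₁ Q₂ := fun r hr =>
    (le_abs_self _).trans ((hQ₁ r hr).trans (le_max_left _ _))
  have hle₂ : ∀ r ∈ Icc c z, U₂ r ≤ max Q₁ Q₂ := fun r hr =>
    (le_abs_self _).trans ((hQ₂ r hr).trans (le_max_right _ _))
  have hrp : ∀ p : ℝ, ContinuousOn (fun r : ℝ => r ^ p) (Icc c z) := fun p r hr =>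
    (continuousAt_rpow_const r p (Or.inl (hmem r hr).1.ne')).continuousWithinAt
  have hφU : ∀ {U V}, IsSolutionOn α γ b φ d U V → (∀ r ∈ Icc c z, U r ≤ max Q₁ Q₂) →
      ContinuousOn (fun r => φ (U r)) (Icc c z) := fun {U V} h hle => by
    have hφc : ContinuousOn φ (Iic (max Q₁ Q₂)) :=
      (LipschitzOnWith.of_dist_le_mul (K := ⟨L, hL.le⟩) fun x hx y hy => hφL x y hx hy).continuousOn
    exact hφc.comp (hUc h) hle
  obtain ⟨P₁, hP₁⟩ := (isCompact_Icc (a := c) (b := z)).exists_bound_of_continuousOn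
    (hφU h₁ hle₁)
  obtain ⟨P₂, hP₂⟩ := (isCompact_Icc (a := c) (b := z)).exists_bound_of_continuousOn
    (hφU h₂ hle₂)
  obtain ⟨C₂, hC₂, hexp⟩ := exists_lipschitz_exp (max P₁ P₂)
  obtain ⟨A₁, hA₁⟩ := (isCompact_Icc (a := c) (b := z)).exists_bound_of_continuousOn
    (hrp (-(α * b)))
  obtain ⟨A₂, hA₂⟩ := (isCompact_Icc (a := c) (b := z)).exists_bound_of_continuousOn (hrp γ)
  have hA₁0 : 0 ≤ A₁ := (norm_nonneg _).trans (hA₁ c ⟨le_rfl, hcz⟩)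
  have hA₂0 : 0 ≤ A₂ := (norm_nonneg _).trans (hA₂ c ⟨le_rfl, hcz⟩)
  refine sub_eq_zero.1 (eq_zero_of_hasDerivAt_le (D := fun r => U₁ r - U₂ r)
    (E := fun r => V₁ r - V₂ r) (C := A₁ * C₁ + A₂ * (C₂ * L)) hcz
    (fun r hr => (h₁.hasDerivAt r (hmem r hr)).sub (h₂.hasDerivAt r (hmem r hr)))
    (fun r hr => (h₁.hasDerivAt_flux r (hmem r hr)).sub (h₂.hasDerivAt_flux r (hmem r hr)))
    (fun r hr => ?_) (fun r hr => ?_) (sub_eq_zero.2 hU) (sub_eq_zero.2 hV))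
  · have h3 := hpow _ ⟨(min_le_left _ _).trans (hmM₁ r hr).1, (hmM₁ r hr).2.trans (le_max_left _ _)⟩
      _ ⟨(min_le_right _ _).trans (hmM₂ r hr).1, (hmM₂ r hr).2.trans (le_max_right _ _)⟩
    have h4 : |r ^ (-(α * b))| * |V₁ r ^ b - V₂ r ^ b| ≤ A₁ * (C₁ * |V₁ r - V₂ r|) :=
      mul_le_mul (hA₁ r hr) h3 (abs_nonneg _) hA₁0
    rw [show -(r ^ (-(α * b)) * V₁ r ^ b) - -(r ^ (-(α * b)) * V₂ r ^ b) =
      -(r ^ (-(α * b)) * (V₁ r ^ b - V₂ r ^ b)) by ring, abs_neg, abs_mul]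
    have h5 : 0 ≤ A₁ * C₁ * |U₁ r - U₂ r| := by positivity
    have h6 : 0 ≤ A₂ * (C₂ * L) * (|U₁ r - U₂ r| + |V₁ r - V₂ r|) := by positivity
    linarith
  · have h3 := hexp _ ((hP₁ r hr).trans (le_max_left _ _)) _ ((hP₂ r hr).trans (le_max_right _ _))
    have h3' : C₂ * |φ (U₁ r) - φ (U₂ r)| ≤ C₂ * (L * |U₁ r - U₂ r|) :=
      mul_le_mul_of_nonneg_left (hφL _ _ (hle₁ r hr) (hle₂ r hr)) hC₂
    have h4 : |r ^ γ| * |exp (φ (U₁ r)) - exp (φ (U₂ r))| ≤ A₂ * (C₂ * (L * |U₁ r - U₂ r|)) :=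
      mul_le_mul (hA₂ r hr) (h3.trans h3') (abs_nonneg _) hA₂0
    rw [← mul_sub, abs_mul]
    have h5 : 0 ≤ A₂ * (C₂ * L) * |V₁ r - V₂ r| := by positivity
    have h6 : 0 ≤ A₁ * C₁ * (|U₁ r - U₂ r| + |V₁ r - V₂ r|) := by positivity
    linarith

theorem transversal (h₁ : IsSolutionOn α γ b φ d U₁ V₁) (h₂ : IsSolutionOn α γ b φ d U₂ V₂)
    (hb : 0 < b) (hφ : ∀ H, ∃ L, 0 < L ∧ ∀ x y, x ≤ H → y ≤ H → |φ x - φ y| ≤ L * |x - y|)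
    {c : ℝ} (hc : 0 < c) (hlt : ∀ r, 0 < r → r ≤ c → U₁ r < U₂ r) :
    Transversal (fun r => U₁ r - U₂ r) (fun r => V₁ r - V₂ r) c d := by
  have hd : ∀ r ∈ Ioc 0 d, HasDerivAt (fun r => U₁ r - U₂ r)
      (-(r ^ (-(α * b)) * (V₁ r ^ b - V₂ r ^ b))) r := fun r hr =>
    ((h₁.hasDerivAt r hr).sub (h₂.hasDerivAt r hr)).congr_deriv (by ring)
  have hne : ∀ z ∈ Ioc 0 d, U₁ z - U₂ z = 0 → V₁ z - V₂ z ≠ 0 := by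
    intro z hz hU hV
    have hcz : c ≤ z := by
      by_contra! h
      exact (hlt z hz.1 h.le).ne (sub_eq_zero.1 hU)
    exact (hlt c hc le_rfl).ne
      (h₁.eq_of_eq_of_flux_eq h₂ hφ hc hcz hz.2 (sub_eq_zero.1 hU) (sub_eq_zero.1 hV))
  refine ⟨fun r hr hrc => sub_neg.2 (hlt r hr hrc), fun r hr =>
    (hd r hr).continuousAt.continuousWithinAt, fun z hz hD σ hσ => ?_, fun z hz hD => ?_, hne⟩
  · have hzp : 0 < z ^ (-(α * b)) := rpow_pos_of_pos hz.1 _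
    have hslope : 0 < σ * -(z ^ (-(α * b)) * (V₁ z ^ b - V₂ z ^ b)) := by
      have hp₁ := h₁.flux_pos z hz
      have hp₂ := h₂.flux_pos z hz
      rcases lt_or_ge 0 (V₁ z - V₂ z) with hE | hE
      · have hσ0 : σ < 0 := by by_contra! h; nlinarith
        have : V₂ z ^ b < V₁ z ^ b := rpow_lt_rpow hp₂.le (by linarith) hb
        exact mul_pos_of_neg_of_neg hσ0 (neg_neg_of_pos (mul_pos hzp (by linarith)))
      · have hE' : V₁ z < V₂ z := by
          have := lt_of_le_of_ne hE (hne z hz hD)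
          linarith
        have hσ0 : 0 < σ := by by_contra! h; nlinarith
        have : V₁ z ^ b < V₂ z ^ b := rpow_lt_rpow hp₁.le hE' hb
        exact mul_pos hσ0 (neg_pos.2 (mul_neg_of_pos_of_neg hzp (by linarith)))
    have h1 := (hasDerivAt_iff_tendsto_slope.1 ((hd z hz).const_mul σ)).eventually
      (lt_mem_nhds hslope)
    filter_upwards [nhdsLT_le_nhdsNE z h1, self_mem_nhdsWithin] with r hr hrz
    have hrz' : r - z < 0 := sub_neg.2 hrz
    rw [slope_def_field, hD, mul_zero, sub_zero] at hr
    by_contra! h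
    exact absurd hr (not_lt.2 (div_nonpos_of_nonneg_of_nonpos h hrz'.le))
  · refine (hd z hz).eventually_ne ?_
    have hp₁ := h₁.flux_pos z hz
    have hp₂ := h₂.flux_pos z hz
    refine neg_ne_zero.2 (mul_ne_zero (rpow_pos_of_pos hz.1 _).ne' (sub_ne_zero.2 fun h => ?_))
    exact hne z hz hD (sub_eq_zero.2 ((rpow_left_inj hp₁.le hp₂.le hb.ne').1 h))

/-- A decreasing classical solution of the radial equation solves the corresponding first order
system. -/
theorem of_hasDerivAt {α β γ d : ℝ} {f U : ℝ → ℝ} (hβ : 0 ≤ β)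
    (hdiff : ∀ r, 0 < r → DifferentiableAt ℝ U r) (hanti : StrictAntiOn U (Ioi 0))
    (hode : ∀ r, 0 < r → HasDerivAt (fun x : ℝ => x ^ α * |deriv U x| ^ β * deriv U x)
      (-(r ^ γ * exp (f (U r)))) r) (hU : ∀ r ∈ Ioc 0 d, 0 ≤ U r) :
    IsSolutionOn α γ (1 / (β + 1)) (clip f) d U
      (fun r => -(r ^ α * |deriv U r| ^ β * deriv U r)) := by
  set V : ℝ → ℝ := fun r => -(r ^ α * |deriv U r| ^ β * deriv U r) with hVdef
  have hβ' : 0 < β + 1 := by linarith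
  have hVd : ∀ r, 0 < r → HasDerivAt V (r ^ γ * exp (f (U r))) r := fun r hr =>
    (hode r hr).neg.congr_deriv (neg_neg _)
  have hnonpos : ∀ r, 0 < r → deriv U r ≤ 0 := by
    intro r hr
    rw [← derivWithin_of_isOpen isOpen_Ioi hr]
    exact hanti.antitoneOn.derivWithin_nonpos
  have hVnonneg : ∀ r, 0 < r → 0 ≤ V r := fun r hr => by
    have h1 : 0 ≤ r ^ α * |deriv U r| ^ β := by positivity
    have := mul_nonpos_of_nonneg_of_nonpos h1 (hnonpos r hr)
    simp only [hVdef]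
    linarith
  have hVmono : StrictMonoOn V (Ioi 0) := by
    refine strictMonoOn_of_deriv_pos (convex_Ioi 0)
      (fun r hr => (hVd r hr).continuousAt.continuousWithinAt) fun r hr => ?_
    rw [interior_Ioi] at hr
    rw [(hVd r hr).deriv]
    exact mul_pos (rpow_pos_of_pos hr _) (exp_pos _)
  have hVpos : ∀ r, 0 < r → 0 < V r := fun r hr =>
    (hVnonneg (r / 2) (half_pos hr)).trans_lt (hVmono (half_pos hr) hr (half_lt_self hr))
  refine ⟨fun r hr => hVpos r hr.1, fun r hr => ?_, fun r hr => ?_⟩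
  · have hr0 := hr.1
    have habs : |deriv U r| = -deriv U r := abs_of_nonpos (hnonpos r hr0)
    have hVeq : V r = r ^ α * (-deriv U r) ^ (β + 1) := by
      have h0 : 0 ≤ -deriv U r := neg_nonneg.2 (hnonpos r hr0)
      rw [rpow_add_of_nonneg h0 hβ zero_le_one, rpow_one]
      simp only [hVdef, habs]
      ring
    have hder : deriv U r = -(r ^ (-(α * (1 / (β + 1)))) * V r ^ (1 / (β + 1))) := by
      have h0 : 0 ≤ -deriv U r := neg_nonneg.2 (hnonpos r hr0)
      rw [hVeq, mul_rpow (by positivity) (by positivity), ← rpow_mul hr0.le, ← rpow_mul h0,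
        mul_one_div_cancel hβ'.ne', rpow_one, rpow_neg hr0.le, inv_mul_cancel_left₀
        (rpow_pos_of_pos hr0 _).ne', neg_neg]
    exact hder ▸ (hdiff r hr0).hasDerivAt
  · rw [clip_of_nonneg (hU r hr)]
    exact hVd r hr.1

end IsSolutionOn

/-- The length scale on which a regular solution with center value `g t` varies by `deriv g t`. -/
noncomputable def scale (b e : ℝ) (g : ℝ → ℝ) (t : ℝ) : ℝ := (exp (-(b * t)) * deriv g t) ^ (1 / e)

namespace IsProfile

variable {f g : ℝ → ℝ} {b e : ℝ}

theorem scale_pos (h : IsProfile f g) {t : ℝ} (ht : f 0 < t) : 0 < scale b e g t :=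
  rpow_pos_of_pos (mul_pos (exp_pos _) (h.deriv_inv_pos ht)) _

theorem scale_rpow (h : IsProfile f g) (he0 : 0 < e) {t : ℝ} (ht : f 0 < t) :
    scale b e g t ^ e = exp (-(b * t)) * deriv g t := by
  rw [scale, ← rpow_mul (mul_pos (exp_pos _) (h.deriv_inv_pos ht)).le, one_div_mul_cancel he0.ne',
    rpow_one]

theorem tendsto_clip_center {α γ : ℝ} {Y : ℝ → ℝ → ℝ} (h : IsProfile f g)
    (hG : SlowlyVarying (deriv g)) (hγ : -1 < γ) (hb : 0 < b) (he : e = (γ + 1 - α) * b + 1)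
    (he0 : 0 < e) (hY : ∀ ρ, 0 < ρ → IsRegular α γ b (clip f) ρ (Y ρ)) :
    ∃ w, IsRegular α γ b id 0 w ∧ ∀ s, 0 ≤ s →
      Tendsto (fun t => clip f (Y (g t) (scale b e g t * s)) - t) atTop (nhds (w s)) := by
  have hlarge := eventually_gt_atTop (f 0)
  obtain ⟨w, hw, hlim⟩ := IsRegular.exists_limit (α := α)
    (ψ := fun t x => clip f (g t + x * deriv g t) - t)
    (w := fun t s => (Y (g t) (scale b e g t * s) - g t) / deriv g t) hγ hb he he0
    (by
      filter_upwards [hlarge] with t ht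
      refine (hY _ (h.inv_pos ht)).rescale h.continuous_clip hγ he (h.scale_pos ht)
        (h.deriv_inv_pos ht) ?_
      rw [h.scale_rpow he0 ht, mul_right_comm, ← exp_add, neg_add_cancel, exp_zero, one_mul])
    (Eventually.of_forall fun t => by
      have := h.continuous_clip
      fun_prop)
    (by
      filter_upwards [hlarge] with t ht x hx
      have h1 := h.monotone_clip (show g t + x * deriv g t ≤ g t by
        nlinarith [h.deriv_inv_pos ht])
      rw [clip_of_nonneg (h.inv_pos ht).le, h.right_inv ht.le] at h1
      linarith)
    (fun W ε hW hε => by simpa only [sub_sub] using h.clip_linearization hG hW hε)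
  refine ⟨w, hw, fun s hs => (hlim s hs).congr' ?_⟩
  filter_upwards [hlarge] with t ht
  rw [div_mul_cancel₀ _ (h.deriv_inv_pos ht).ne', add_sub_cancel]

theorem tendsto_scale (h : IsProfile f g) (hG : SlowlyVarying (deriv g)) (hb : 0 < b)
    (he0 : 0 < e) (hint : IntegrableOn (fun s => exp (-(b * f s))) (Ici 0)) :
    Tendsto (scale b e g) atTop (nhds 0) := by
  have h1 := tendsto_weight (T₀ := f 0 + 1) hb hG (fun t ht => h.deriv_inv_pos (by linarith))
    (fun t ht => h.hasDerivAt_tail_inv hint (by linarith))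
    ((tendsto_tail hint).comp h.tendsto_inv)
  have h2 := h1.rpow_const (p := 1 / e) (Or.inr (by positivity))
  rwa [zero_rpow (by positivity)] at h2

theorem tendsto_clip_singular {U : ℝ → ℝ} {k s : ℝ} (h : IsProfile f g)
    (hG : SlowlyVarying (deriv g)) (hb : 0 < b) (he0 : 0 < e)
    (hint : IntegrableOn (fun s => exp (-(b * f s))) (Ici 0))
    (hU : Tendsto U (nhdsWithin 0 (Ioi 0)) atTop) (hk : 0 < k)
    (htail : Tendsto (fun r => tail b f (U r) / r ^ e) (nhdsWithin 0 (Ioi 0)) (nhds k))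
    (hs : 0 < s) :
    Tendsto (fun t => clip f (U (scale b e g t * s)) - t) atTop
      (nhds (-(log (b * k * s ^ e) / b))) := by
  set y := -(log (b * k * s ^ e) / b) with hy
  have hse : 0 < s ^ e := rpow_pos_of_pos hs e
  have hexp : ∀ z, exp (-(b * z)) / b < k * s ^ e ↔ y < z := by
    intro z
    rw [div_lt_iff₀ hb, show k * s ^ e * b = b * k * s ^ e by ring,
      ← lt_log_iff_exp_lt (by positivity), hy, ← neg_div, div_lt_iff₀ hb]
    constructor <;> intro <;> linarith
  have hexp' : ∀ z, k * s ^ e < exp (-(b * z)) / b ↔ z < y := by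
    intro z
    rw [lt_div_iff₀ hb, show k * s ^ e * b = b * k * s ^ e by ring,
      ← log_lt_iff_lt_exp (by positivity), hy, ← neg_div, lt_div_iff₀ hb]
    constructor <;> intro <;> linarith
  have hlarge := eventually_gt_atTop (f 0)
  have hscale : Tendsto (fun t => scale b e g t * s) atTop (nhdsWithin 0 (Ioi 0)) := by
    refine tendsto_nhdsWithin_iff.2 ⟨by
      simpa using (h.tendsto_scale (e := e) hG hb he0 hint).mul_const s, ?_⟩
    filter_upwards [hlarge] with t ht using mul_pos (h.scale_pos ht) hs
  have hx0 := (hU.comp hscale).eventually_ge_atTop 0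
  have hw : ∀ t, f 0 < t → 0 < exp (-(b * t)) * deriv g t := fun t ht =>
    mul_pos (exp_pos _) (h.deriv_inv_pos ht)
  have hlimU : Tendsto (fun t => tail b f (U (scale b e g t * s)) / (exp (-(b * t)) * deriv g t))
      atTop (nhds (k * s ^ e)) := by
    refine ((htail.comp hscale).mul_const (s ^ e)).congr' ?_
    filter_upwards [hlarge] with t ht
    rw [Function.comp_apply, mul_rpow (h.scale_pos ht).le hs.le, h.scale_rpow he0 ht]
    have := (hw t ht).ne'
    field_simp
  have hlimg := fun z => tendsto_tail_shift_div (T₀ := f 0 + 1) hb hG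
    (fun t ht => h.deriv_inv_pos (by linarith))
    (fun t ht => h.hasDerivAt_tail_inv hint (by linarith))
    ((tendsto_tail hint).comp h.tendsto_inv) z
  have hanti := tail_antitoneOn hint
  refine tendsto_order.2 ⟨fun a ha => ?_, fun a ha => ?_⟩
  · obtain ⟨z, haz, hzy⟩ := exists_between ha
    filter_upwards [hlimU.eventually_lt (hlimg z) ((hexp' z).2 hzy), hlarge, hx0,
      eventually_ge_atTop (f 0 - z)] with t h1 ht hx htz
    have h2 := (div_lt_div_iff_of_pos_right (hw t ht)).1 h1
    have htz' : f 0 ≤ t + z := by linarith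
    have h3 : g (t + z) < U (scale b e g t * s) := by
      by_contra! h4
      exact h2.not_ge (hanti hx (h.inv_nonneg htz') h4)
    have h5 := h.monotone_clip h3.le
    rw [clip_of_nonneg (h.inv_nonneg htz'), h.right_inv htz'] at h5
    linarith
  · obtain ⟨z, hyz, hza⟩ := exists_between ha
    filter_upwards [(hlimg z).eventually_lt hlimU ((hexp z).2 hyz), hlarge, hx0,
      eventually_ge_atTop (f 0 - z)] with t h1 ht hx htz
    have h2 := (div_lt_div_iff_of_pos_right (hw t ht)).1 h1
    have htz' : f 0 ≤ t + z := by linarith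
    have h3 : U (scale b e g t * s) < g (t + z) := by
      by_contra! h4
      exact h2.not_ge (hanti (h.inv_nonneg htz') hx h4)
    have h5 := h.monotone_clip h3.le
    rw [clip_of_nonneg (h.inv_nonneg htz'), h.right_inv htz'] at h5
    linarith

end IsProfile

theorem exists_strictMono_alternating {Δ : ℝ → ℝ} (hneg : ∀ S, ∃ s, 0 < s ∧ S < s ∧ Δ s < 0)
    (hpos : ∀ S, ∃ s, 0 < s ∧ S < s ∧ 0 < Δ s) :
    ∃ s : ℕ → ℝ, StrictMono s ∧ ∀ i, 0 < s i ∧ (-1) ^ i * Δ (s i) < 0 := by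
  have hstep : ∀ (i : ℕ) (S : ℝ), ∃ s, 0 < s ∧ S < s ∧ (-1) ^ i * Δ s < 0 := by
    intro i S
    rcases i.even_or_odd with hi | hi
    · simpa [hi.neg_one_pow] using hneg S
    · simpa [hi.neg_one_pow] using hpos S
  choose φ hφ0 hφS hφ using hstep
  let s : ℕ → ℝ := fun i => Nat.rec (φ 0 0) (fun i x => φ (i + 1) x) i
  refine ⟨s, strictMono_nat_of_lt_succ fun i => hφS (i + 1) (s i), fun i => ?_⟩
  cases i with
  | zero => exact ⟨hφ0 0 0, hφ 0 0⟩
  | succ i => exact ⟨hφ0 _ _, hφ _ _⟩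

/-- Regular solutions with large center value cross a singular solution arbitrarily often. -/
theorem eventually_alternates {α γ a b θ k d : ℝ} {f g U : ℝ → ℝ} {Y : ℝ → ℝ → ℝ}
    (h : IsProfile f g) (hG : SlowlyVarying (deriv g)) (hγ : -1 < γ) (hb : 0 < b) (ha : 0 < a)
    (hab : a * b = α * b - 1) (hθ : 0 < θ) (hθγ : θ = γ + 1 - a) (hcond : a < 4 * (θ * b))
    (hint : IntegrableOn (fun s => exp (-(b * f s))) (Ici 0))
    (hY : ∀ ρ, 0 < ρ → IsRegular α γ b (clip f) ρ (Y ρ))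
    (hU : Tendsto U (nhdsWithin 0 (Ioi 0)) atTop) (hk : k = 1 / (b * θ) * a ^ (-b))
    (htail : Tendsto (fun r => tail b f (U r) / r ^ (θ * b)) (nhdsWithin 0 (Ioi 0)) (nhds k))
    (hd : 0 < d) (n : ℕ) :
    ∀ᶠ t in atTop, Alternates (fun r => Y (g t) r - U r) d n := by
  have he0 : 0 < θ * b := mul_pos hθ hb
  have he : θ * b = (γ + 1 - α) * b + 1 := by rw [hθγ]; linarith
  have hk0 : 0 < k := by rw [hk]; positivity
  obtain ⟨w, hw, hlim⟩ := h.tendsto_clip_center hG hγ hb he he0 hY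
  have hwstar : ∀ s, 0 < s →
      -(log (b * k * s ^ (θ * b)) / b) = log (a * θ ^ (1 / b)) - θ * log s := by
    intro s hs
    rw [hk, show b * (1 / (b * θ) * a ^ (-b)) * s ^ (θ * b) = θ⁻¹ * a ^ (-b) * s ^ (θ * b) by
      field_simp, log_mul (by positivity) (by positivity), log_mul (by positivity) (by positivity),
      log_mul (by positivity) (by positivity), log_rpow hs, log_rpow ha, log_rpow hθ, log_inv]
    field_simp
    ring
  have hosc := fun S => hw.oscillates hγ hb ha hab hθ hθγ hcond S
  obtain ⟨s, hsm, hs⟩ := exists_strictMono_alternating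
    (Δ := fun s => w s - (log (a * θ ^ (1 / b)) - θ * log s))
    (fun S => by simpa only [sub_neg] using (hosc S).1)
    (fun S => by simpa only [sub_pos] using (hosc S).2)
  have hev : ∀ i, ∀ᶠ t in atTop, scale b (θ * b) g t * s i ∈ Ioc 0 d ∧
      (-1) ^ i * (Y (g t) (scale b (θ * b) g t * s i) - U (scale b (θ * b) g t * s i)) < 0 := by
    intro i
    have h1 := (hlim (s i) (hs i).1.le).sub
      (h.tendsto_clip_singular hG hb he0 hint hU hk0 htail (hs i).1)
    rw [hwstar _ (hs i).1] at h1
    have h2 := (h1.const_mul ((-1) ^ i)).eventually_lt_const (hs i).2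
    have h3 := ((h.tendsto_scale (e := θ * b) hG hb he0 hint).mul_const (s i)).eventually_le_const
      (show 0 * s i < d by simpa using hd)
    filter_upwards [h2, h3, eventually_gt_atTop (f 0)] with t h2 h3 ht
    refine ⟨⟨mul_pos (h.scale_pos ht) (hs i).1, h3⟩, ?_⟩
    rcases i.even_or_odd with hi | hi
    · rw [hi.neg_one_pow] at h2 ⊢
      linarith [h.monotone_clip.reflect_lt (a := Y (g t) (scale b (θ * b) g t * s i))
        (b := U (scale b (θ * b) g t * s i)) (by linarith)]
    · rw [hi.neg_one_pow] at h2 ⊢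
      linarith [h.monotone_clip.reflect_lt (b := Y (g t) (scale b (θ * b) g t * s i))
        (a := U (scale b (θ * b) g t * s i)) (by linarith)]
  filter_upwards [(Finset.range n).eventually_all.2 fun i _ => hev i, eventually_gt_atTop (f 0)]
    with t ht ht0
  exact ⟨fun i => scale b (θ * b) g t * s i, fun i hi => (ht i (Finset.mem_range.2 hi)).1,
    fun i _ => mul_lt_mul_of_pos_left (hsm i.lt_succ_self) (h.scale_pos ht0),
    fun i hi => (ht i (Finset.mem_range.2 hi)).2⟩

section Comparison

variable {α γ b e d : ℝ} {f g U V : ℝ → ℝ} {Y : ℝ → ℝ → ℝ}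
  (h : IsProfile f g) (hγ : -1 < γ) (hb : 0 < b) (he : e = (γ + 1 - α) * b + 1) (he0 : 0 < e)
  (hY : ∀ ρ, 0 < ρ → IsRegular α γ b (clip f) ρ (Y ρ))

include h hγ hb he he0 hY

theorem continuousOn_apply (hd : 0 ≤ d) {ρ₀ ρ₁ : ℝ} (hρ₀ : 0 < ρ₀) :
    ContinuousOn (fun ρ => Y ρ d) (Icc ρ₀ ρ₁) := by
  obtain ⟨L, hL, hφL⟩ := h.clip_lipschitz ρ₁
  exact (IsRegular.continuousOn_family (fun ρ hρ => hY ρ (hρ₀.trans_le hρ.1)) h.continuous_clip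
    h.monotone_clip hL hφL hγ hb he he0 d).comp (f := fun ρ => (ρ, d)) (by fun_prop)
    fun ρ hρ => ⟨hρ, hd, le_rfl⟩

theorem exists_end_sign (hV : IsSolutionOn α γ b (clip f) d U V)
    (hU : Tendsto U (nhdsWithin 0 (Ioi 0)) atTop)
    (hA : ∀ n, ∀ᶠ t in atTop, Alternates (fun r => Y (g t) r - U r) d n) (p : ℕ) {M : ℝ}
    (hM : 0 < M) : ∃ ρ, M < ρ ∧ 0 < (-1) ^ p * (Y ρ d - U d) := by
  by_contra! hcon
  have hnear : ∀ H, ∃ c, 0 < c ∧ ∀ r, 0 < r → r ≤ c → H < U r := by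
    intro H
    obtain ⟨c, hc, hcU⟩ := mem_nhdsGT_iff_exists_Ioc_subset.1 (hU.eventually_gt_atTop H)
    exact ⟨c, hc, fun r hr hrc => hcU ⟨hr, hrc⟩⟩
  have htrans : ∀ {c H}, 0 < c → (∀ r, 0 < r → r ≤ c → H < U r) → ∀ ρ, 0 < ρ → ρ ≤ H →
      Transversal (fun r => Y ρ r - U r) (fun r => flux γ (fun s => clip f (Y ρ s)) r - V r) c d :=
    fun hc hcU ρ hρ hρH =>
      ((hY ρ hρ).isSolutionOn h.continuous_clip hγ hb he he0).transversal hV hb h.clip_lipschitz hc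
        fun r hr hrc => (((hY ρ hρ).le_center h.continuous_clip hγ hb he he0 hr.le).trans
          hρH).trans_lt (hcU r hr hrc)
  have hM1 : 0 < M + 1 := by linarith
  obtain ⟨c₀, hc₀, hcU₀⟩ := hnear (M + 1)
  obtain ⟨N, hN⟩ := (htrans hc₀ hcU₀ (M + 1) hM1 le_rfl).exists_bound hc₀
  have hpar : ∀ x : ℝ, (-1) ^ (2 * (N + 1) + p) * x = (-1) ^ p * x := fun x => by
    rw [pow_add, pow_mul]; simp
  obtain ⟨t, ht, htM⟩ := ((hA (2 * (N + 1) + p)).and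
    (h.tendsto_inv.eventually_ge_atTop (M + 1))).exists
  obtain ⟨c, hc, hcU⟩ := hnear (g t)
  obtain ⟨L, hL, hφL⟩ := h.clip_lipschitz (g t)
  have hY' : ∀ ρ ∈ Icc (M + 1) (g t), IsRegular α γ b (clip f) ρ (Y ρ) := fun ρ hρ =>
    hY ρ (hM1.trans_le hρ.1)
  have hsub : Icc (M + 1) (g t) ×ˢ Ioc 0 d ⊆ Icc (M + 1) (g t) ×ˢ Icc 0 d :=
    prod_mono_right Ioc_subset_Icc_self
  have hsnd : ∀ {W : ℝ → ℝ}, ContinuousOn W (Ioc 0 d) →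
      ContinuousOn (fun q : ℝ × ℝ => W q.2) (Icc (M + 1) (g t) ×ˢ Ioc 0 d) := fun hW =>
    hW.comp continuousOn_snd fun q hq => hq.2
  refine hN (2 * (N + 1) + p) (by omega) (by
    rw [hpar]; exact hcon (M + 1) (lt_add_one M)) ?_
  exact alternates_of_family (D := fun ρ r => Y ρ r - U r)
    (E := fun ρ r => flux γ (fun s => clip f (Y ρ s)) r - V r) hc htM
    (fun ρ hρ => htrans hc hcU ρ (hM1.trans_le hρ.1) hρ.2)
    (((IsRegular.continuousOn_family hY' h.continuous_clip h.monotone_clip hL hφL hγ hb he he0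
      d).mono hsub).sub (hsnd fun r hr => (hV.hasDerivAt r hr).continuousAt.continuousWithinAt))
    (((IsRegular.continuousOn_flux_family hY' h.continuous_clip h.monotone_clip hL hφL hγ hb he he0
      d).mono hsub).sub
        (hsnd fun r hr => (hV.hasDerivAt_flux r hr).continuousAt.continuousWithinAt))
    (fun ρ hρ => by rw [hpar]; exact hcon ρ (by linarith [hρ.1])) ht

end Comparison

theorem IsProfile.integrableOn_of_tail_pos {f g : ℝ → ℝ} {b x : ℝ} (h : IsProfile f g)
    (hx : 0 < tail b f x) : IntegrableOn (fun s => exp (-(b * f s))) (Ici 0) := by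
  refine h.integrableOn_of_Ici (x := x) ?_
  by_contra hcon
  exact hx.ne' (integral_undef hcon)

end RadialLiouville

open RadialLiouville

/-- Theorem 1.2 / 4.4: under (A1)–(A6) and α − β − 1 < 4θ/(β+1), the bifurcation
parameter λ(ρ) = R(0,ρ)^θ of the family of regular solutions oscillates around λ*
as ρ → +∞; in particular the set {ρ : λ(ρ) = λ*} is unbounded. -/
theorem stmt_2 (α β γ θ : ℝ) (hθ : θ = γ + 2 + β - α) (f g : ℝ → ℝ)
    -- (A1): f is C⁴ on [0,∞), increasing, tending to +∞; g is its inverse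
    (hf : ContDiffOn ℝ 4 f (Ici 0))
    (hf' : ∀ u ∈ Ici (0:ℝ), 0 < deriv f u)
    (hftop : Tendsto f atTop atTop)
    (hgf : ∀ u ∈ Ici (0:ℝ), g (f u) = u)
    (hfg : ∀ t ∈ Ici (f 0), f (g t) = t)
    -- (A2)
    (hA2a : Tendsto (fun t => deriv (deriv g) t) atTop (nhds 0))
    (hA2b : ∀ ε : ℝ → ℝ, (ε =O[atTop] fun t => deriv (deriv g) t) →
      Tendsto (fun t => f (g t + ε t) / t) atTop (nhds 1))
    -- (A3)
    (hA3 : ∀ h : ℝ → ℝ, (h =o[atTop] fun t : ℝ => t) →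
      Tendsto (fun t => deriv g t / deriv g (t + h t)) atTop (nhds 1))
    -- (A4)
    (hA4 : Tendsto (fun t => deriv (deriv g) t / deriv g t * Real.log (deriv g t))
      atTop (nhds 0))
    -- (A5)
    (hA5a : ∀ n : ℕ, n ≤ 2 →
      (fun t => deriv (deriv (deriv g)) t * Real.log (deriv g t) ^ n)
        =O[atTop] fun t => deriv (deriv g) t)
    (hA5b : (fun t => deriv (deriv (deriv (deriv g))) t * Real.log (deriv g t))
        =O[atTop] fun t => deriv (deriv g) t)
    (hA5c : ∃ C : ℝ, ∀ᶠ t in atTop, ∀ s, t ≤ s →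
      |deriv (deriv g) s| ≤ C * |deriv (deriv g) t|)
    (hA5d : ∀ h : ℝ → ℝ, (h =o[atTop] fun t : ℝ => t) →
      (fun t => deriv (deriv g) (t + h t)) =O[atTop] fun t => deriv (deriv g) t)
    -- (A6)
    (hαβ : α > β + 1) (hβ : 0 ≤ β) (hθpos : 0 < θ)
    (hcond : α - β - 1 < 4 * θ / (β + 1))
    -- the family of regular solutions of L(u) + e^{f(u)} = 0, u(0,ρ)=ρ, ∂_r u(0,ρ)=0,
    -- given as the unique continuous solution of the integral equation
    (u : ℝ → ℝ → ℝ)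
    (hucont : ∀ ρ, 0 < ρ → ContinuousOn (u ρ) (Ici 0))
    (hueq : ∀ ρ, 0 < ρ → ∀ r, 0 ≤ r →
      u ρ r = ρ - ∫ t in (0:ℝ)..r, t ^ (-(α / (β + 1))) *
        (∫ s in (0:ℝ)..t, s ^ γ * Real.exp (f (u ρ s))) ^ ((1:ℝ) / (β + 1)))
    -- R(0,ρ) : the unique zero of u(·,ρ); λ(ρ) = R(0,ρ)^θ
    (R lam : ℝ → ℝ)
    (hR : ∀ ρ, 0 < ρ → 0 < R ρ ∧ u ρ (R ρ) = 0 ∧ ∀ r, 0 < r → u ρ r = 0 → r = R ρ)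
    (hlam : ∀ ρ, lam ρ = R ρ ^ θ)
    -- u* : a C², strictly decreasing singular solution on (0,∞) with the stated
    -- representation F(u*(r)) = K r^{θ/(β+1)} (1 + δ(r)), δ(r) → 0 as r → 0+
    (ustar δ : ℝ → ℝ)
    (hstarC2 : ContDiffOn ℝ 2 ustar (Ioi 0))
    (hstarAnti : StrictAntiOn ustar (Ioi 0))
    (hstarODE : ∀ r, 0 < r →
      HasDerivAt (fun x : ℝ => x ^ α * |deriv ustar x| ^ β * deriv ustar x)
        (-(r ^ γ * Real.exp (f (ustar r)))) r)
    (hstarBlow : Tendsto ustar (nhdsWithin 0 (Ioi 0)) atTop)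
    (hδ : Tendsto δ (nhdsWithin 0 (Ioi 0)) (nhds 0))
    (hrep : ∀ r, 0 < r →
      (∫ s in Ici (ustar r), Real.exp (-f s / (β + 1))) =
        (β + 1) / θ * (α - β - 1) ^ (-((1:ℝ) / (β + 1))) * r ^ (θ / (β + 1)) * (1 + δ r))
    -- λ* > 0 with (λ*)^{1/θ} the unique zero of u*
    (lamstar : ℝ) (hlamstarpos : 0 < lamstar)
    (hstarZero : ustar (lamstar ^ ((1:ℝ) / θ)) = 0)
    (hstarZeroUnique : ∀ r, 0 < r → ustar r = 0 → r = lamstar ^ ((1:ℝ) / θ)) :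
    -- (i) λ(ρ) oscillates around λ* as ρ → +∞
    ((∀ M, 0 < M → ∃ ρ₁, M < ρ₁ ∧ lamstar < lam ρ₁) ∧
      (∀ M, 0 < M → ∃ ρ₂, M < ρ₂ ∧ lam ρ₂ < lamstar)) ∧
    -- (ii) { ρ > 0 : λ(ρ) = λ* } is unbounded
    (∀ M, 0 < M → ∃ ρ, M < ρ ∧ lam ρ = lamstar) := by
  have hβ1 : 0 < β + 1 := by linarith
  set b : ℝ := 1 / (β + 1) with hbdef
  set a : ℝ := α - β - 1 with hadef
  set d : ℝ := lamstar ^ (1 / θ) with hd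
  have hb : 0 < b := by positivity
  have hβb : (β + 1) * b = 1 := mul_one_div_cancel hβ1.ne'
  have ha : 0 < a := by linarith
  have hab : a * b = α * b - 1 := by linear_combination -hβb
  have hθγ : θ = γ + 1 - a := by rw [hθ, hadef]; ring
  have hγ : -1 < γ := by linarith
  have he0 : 0 < θ * b := mul_pos hθpos hb
  have he : θ * b = (γ + 1 - α) * b + 1 := by rw [hθγ]; linarith
  have hcond' : a < 4 * (θ * b) := by rwa [← mul_assoc, hbdef, mul_one_div]
  have hd0 : 0 < d := rpow_pos_of_pos hlamstarpos _
  have hprof : IsProfile f g := ⟨hf, hf', hftop, hgf⟩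
  have hG : SlowlyVarying (deriv g) := slowlyVarying_of_tendsto
    ((eventually_gt_atTop (f 0)).mono fun t ht => hprof.deriv_inv_pos ht) hA3
  have hY : ∀ ρ, ∃ y, 0 < ρ → IsRegular α γ b (clip f) ρ y ∧ y (R ρ) = 0 := by
    intro ρ
    by_cases hρ : 0 < ρ
    · obtain ⟨hR0, hRu, hRuniq⟩ := hR ρ hρ
      obtain ⟨y, hy⟩ := IsRegular.exists_of_integral_eq hprof hγ hb he he0 hρ (hucont ρ hρ)
        (fun r hr => by
          rw [hueq ρ hρ r hr, show α / (β + 1) = α * b by rw [hbdef, mul_one_div]]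
          rfl) hR0 hRu hRuniq
      exact ⟨y, fun _ => hy⟩
    · exact ⟨0, fun h => absurd h hρ⟩
  choose Y hY using hY
  have hYreg := fun ρ hρ => (hY ρ hρ).1
  have hYanti := fun ρ hρ =>
    (hYreg ρ hρ).strictAntiOn hprof.continuous_clip hγ hb he he0
  have hRmem : ∀ ρ, 0 < ρ → R ρ ∈ Ici (0 : ℝ) := fun ρ hρ => (hR ρ hρ).1.le
  have hdθ : d ^ θ = lamstar := by
    rw [hd, ← rpow_mul hlamstarpos.le, one_div_mul_cancel hθpos.ne', rpow_one]
  have hrep' : ∀ r, 0 < r → tail b f (ustar r) =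
      1 / (b * θ) * a ^ (-b) * r ^ (θ * b) * (1 + δ r) := by
    intro r hr
    have h1 := hrep r hr
    rw [show θ / (β + 1) = θ * b by rw [hbdef, mul_one_div],
      show (β + 1) / θ = 1 / (b * θ) by rw [hbdef]; field_simp] at h1
    rw [← h1, tail]
    refine setIntegral_congr_fun measurableSet_Ici fun s _ => ?_
    simp only [hbdef]
    congr 1
    ring
  have htail : Tendsto (fun r => tail b f (ustar r) / r ^ (θ * b)) (nhdsWithin 0 (Ioi 0))
      (nhds (1 / (b * θ) * a ^ (-b))) := by
    have h1 := (hδ.const_add 1).const_mul (1 / (b * θ) * a ^ (-b))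
    rw [add_zero, mul_one] at h1
    refine h1.congr' ?_
    filter_upwards [self_mem_nhdsWithin] with r hr
    have : r ^ (θ * b) ≠ 0 := (rpow_pos_of_pos hr _).ne'
    rw [hrep' r hr, mul_right_comm (1 / (b * θ) * a ^ (-b)), mul_div_cancel_right₀ _ this]
  have hint : IntegrableOn (fun s => exp (-(b * f s))) (Ici 0) := by
    obtain ⟨r, hr, hr0⟩ := ((htail.eventually_const_lt (by positivity)).and
      self_mem_nhdsWithin).exists
    exact hprof.integrableOn_of_tail_pos ((div_pos_iff_of_pos_right (rpow_pos_of_pos hr0 _)).1 hr)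
  have hsol := IsSolutionOn.of_hasDerivAt (d := d) hβ
    (fun r hr => (hstarC2.differentiableOn (by norm_num)).differentiableAt (Ioi_mem_nhds hr))
    hstarAnti hstarODE
    (fun r hr => hstarZero ▸ hstarAnti.antitoneOn hr.1 hd0 hr.2)
  have hsign := exists_end_sign hprof hγ hb he he0 hYreg hsol hstarBlow
    (eventually_alternates hprof hG hγ hb ha hab hθpos hθγ hcond' hint hYreg hstarBlow rfl
      htail hd0)
  rw [hstarZero] at hsign
  have hup : ∀ M, 0 < M → ∃ ρ, M < ρ ∧ 0 < Y ρ d := fun M hM => by simpa using hsign 0 hM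
  have hdown : ∀ M, 0 < M → ∃ ρ, M < ρ ∧ Y ρ d < 0 := fun M hM => by simpa using hsign 1 hM
  refine ⟨⟨fun M hM => ?_, fun M hM => ?_⟩, fun M hM => ?_⟩
  · obtain ⟨ρ, hρM, hρ⟩ := hup M hM
    have hρ0 := hM.trans hρM
    refine ⟨ρ, hρM, ?_⟩
    rw [hlam, ← hdθ]
    refine rpow_lt_rpow hd0.le (((hYanti ρ hρ0).lt_iff_gt (hRmem ρ hρ0) hd0.le).1 ?_) hθpos
    rwa [(hY ρ hρ0).2]
  · obtain ⟨ρ, hρM, hρ⟩ := hdown M hM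
    have hρ0 := hM.trans hρM
    refine ⟨ρ, hρM, ?_⟩
    rw [hlam, ← hdθ]
    refine rpow_lt_rpow (hRmem ρ hρ0) (((hYanti ρ hρ0).lt_iff_gt hd0.le (hRmem ρ hρ0)).1 ?_) hθpos
    rwa [(hY ρ hρ0).2]
  · obtain ⟨ρ₁, hρ₁M, hρ₁⟩ := hup M hM
    obtain ⟨ρ₂, hρ₂M, hρ₂⟩ := hdown ρ₁ (hM.trans hρ₁M)
    obtain ⟨ρ, hρ, hρd⟩ := intermediate_value_Icc' hρ₂M.le
      (continuousOn_apply hprof hγ hb he he0 hYreg hd0.le (hM.trans hρ₁M)) ⟨hρ₂.le, hρ₁.le⟩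
    have hρM := hρ₁M.trans_le hρ.1
    have hρ0 := hM.trans hρM
    refine ⟨ρ, hρM, ?_⟩
    rw [hlam, ← hdθ, (hYanti ρ hρ0).injOn (hRmem ρ hρ0) hd0.le ((hY ρ hρ0).2.trans hρd.symm)]
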